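/- Let G₀ be a discrete convergence group acting on a compact metrizable space M, let J₁, J₋₁ ≤ G₀ be geometrically finite subgroups, and let f ∈ Homeo(M) generate an infinite cyclic discrete convergence group with f J₋₁ f⁻¹ = J₁. Suppose G₀ is in HNN ping-pong position with respect to f, J₁ and J₋₁. Let G = ⟨G₀, f⟩ ≤ Homeo(M) and suppose G acts on M as a convergence group. Then G is geometrically finite if and only if G₀ is geometrically finite. -/

import Mathlib

open Filter Topology Set

namespace ConvergenceGroups

variable {M : Type*} [TopologicalSpace M]

/-- The group of self-homeomorphisms of `M`, with `(g * h) x = g (h x)`. -/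
instance : Group (M ≃ₜ M) where
  mul g h := h.trans g
  one := Homeomorph.refl M
  inv := Homeomorph.symm
  mul_assoc _ _ _ := rfl
  one_mul _ := Homeomorph.ext fun _ => rfl
  mul_one _ := Homeomorph.ext fun _ => rfl
  inv_mul_cancel g := Homeomorph.ext fun x => g.symm_apply_apply x

/-- The inclusion of the self-homeomorphisms of `M` into the continuous self-maps of `M`;
the latter carries the compact-open topology. -/
def toCM (g : M ≃ₜ M) : C(M, M) := ⟨⇑g, g.continuous⟩

/-- `(g k)` is a convergence sequence with attracting point `zp` and repelling point `zm`:
the maps `g k` converge to the constant map `zp` uniformly on compact subsets of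
`M ∖ {zm}`. -/
def IsConvSeq (g : ℕ → M ≃ₜ M) (zp zm : M) : Prop :=
  ∀ K : Set M, IsCompact K → zm ∉ K → ∀ U ∈ 𝓝 zp,
    ∀ᶠ k in atTop, ∀ x ∈ K, g k x ∈ U

/-- `(g k)` converges in the compact-open topology to a homeomorphism. -/
def TendstoHomeo (g : ℕ → M ≃ₜ M) : Prop :=
  ∃ h : M ≃ₜ M, Tendsto (fun k => toCM (g k)) atTop (𝓝 (toCM h))

/-- `G` acts on `M` as a convergence group: every sequence of pairwise distinct elements of
`G` has a subsequence which either converges in the compact-open topology to a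
homeomorphism, or is a convergence sequence. -/
def IsConvGroup (G : Subgroup (M ≃ₜ M)) : Prop :=
  ∀ g : ℕ → M ≃ₜ M, (∀ k, g k ∈ G) → Function.Injective g →
    ∃ φ : ℕ → ℕ, StrictMono φ ∧
      (TendstoHomeo (g ∘ φ) ∨ ∃ zp zm : M, IsConvSeq (g ∘ φ) zp zm)

/-- `G` acts on `M` as a discrete convergence group: every sequence of pairwise distinct
elements of `G` has a subsequence which is a convergence sequence. -/
def IsDiscreteConvGroup (G : Subgroup (M ≃ₜ M)) : Prop :=
  ∀ g : ℕ → M ≃ₜ M, (∀ k, g k ∈ G) → Function.Injective g →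
    ∃ φ : ℕ → ℕ, StrictMono φ ∧ ∃ zp zm : M, IsConvSeq (g ∘ φ) zp zm

/-- The limit set `Λ(G)`: the set of all attracting points of convergence sequences in `G`. -/
def limitSet (G : Subgroup (M ≃ₜ M)) : Set M :=
  {zp | ∃ g : ℕ → M ≃ₜ M, (∀ k, g k ∈ G) ∧ Function.Injective g ∧
    ∃ zm : M, IsConvSeq g zp zm}

/-- `x` is a conical limit point for `G`: there is a sequence of pairwise distinct elements
`g k` of `G` such that for every `z ≠ x` the pairs `(g k x, g k z)` remain in a compact
subset of `(M × M) ∖ Δ`. -/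
def IsConicalLimitPt (G : Subgroup (M ≃ₜ M)) (x : M) : Prop :=
  ∃ g : ℕ → M ≃ₜ M, (∀ k, g k ∈ G) ∧ Function.Injective g ∧
    ∀ z : M, z ≠ x → ∃ K : Set (M × M), IsCompact K ∧ (∀ p ∈ K, p.1 ≠ p.2) ∧
      ∀ k, (g k x, g k z) ∈ K

/-- `g` is elliptic: the closure of the cyclic group generated by `g` is compact in
`Homeo(M)` (viewed inside `C(M, M)` with the compact-open topology). -/
def IsEllipticElem (g : M ≃ₜ M) : Prop :=
  IsCompact (closure (Set.range fun n : ℤ => toCM (g ^ n))) ∧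
    closure (Set.range fun n : ℤ => toCM (g ^ n)) ⊆ Set.range (toCM (M := M))

/-- `g` is parabolic: not elliptic, and fixes exactly one point of `M`. -/
def IsParabolicElem (g : M ≃ₜ M) : Prop :=
  ¬IsEllipticElem g ∧ ∃! x : M, g x = x

/-- `g` is loxodromic: not elliptic, and fixes exactly two points of `M`. -/
def IsLoxodromicElem (g : M ≃ₜ M) : Prop :=
  ¬IsEllipticElem g ∧ ∃ a b : M, a ≠ b ∧ {x : M | g x = x} = {a, b}

/-- `p` is a parabolic point for `G`: it is the fixed point of a parabolic element of `G`. -/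
def IsParabolicPt (G : Subgroup (M ≃ₜ M)) (p : M) : Prop :=
  ∃ g ∈ G, IsParabolicElem g ∧ g p = p

/-- `p` is a bounded parabolic point for `G`: it is a parabolic point and the quotient of
`Λ(G) ∖ {p}` by the stabilizer of `p` in `G` is compact. -/
def IsBoundedParabolicPt (G : Subgroup (M ≃ₜ M)) (p : M) : Prop :=
  IsParabolicPt G p ∧
    ∃ K : Set M, IsCompact K ∧ K ⊆ limitSet G \ {p} ∧
      ∀ x ∈ limitSet G \ {p}, ∃ h ∈ G, h p = p ∧ h x ∈ K

/-- `G` is geometrically finite: every point of `Λ(G)` is a conical limit point or a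
bounded parabolic point. -/
def IsGeomFinite (G : Subgroup (M ≃ₜ M)) : Prop :=
  ∀ x ∈ limitSet G, IsConicalLimitPt G x ∨ IsBoundedParabolicPt G x

/-- `J` is a fully quasi-convex subgroup of `G`: `J ≤ G`, `J` acts geometrically finitely,
and `g Λ(J) ∩ Λ(J) = ∅` for all but finitely many left cosets `gJ`. -/
def IsFullyQuasiconvex (G J : Subgroup (M ≃ₜ M)) : Prop :=
  J ≤ G ∧ IsGeomFinite J ∧
    ∃ F : Set (M ≃ₜ M), F.Finite ∧ ∀ g ∈ G,
      (⇑g '' limitSet J ∩ limitSet J).Nonempty → ∃ f ∈ F, ∃ j ∈ J, g = f * j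

/-- `G₁` and `G₂` are in AFP ping-pong position with respect to `J = G₁ ∩ G₂`, witnessed by
the closed sets `B₁`, `B₂`. -/
structure AFPPingPong (G₁ G₂ J : Subgroup (M ≃ₜ M)) (B₁ B₂ : Set M) : Prop where
  isClosed₁ : IsClosed B₁
  isClosed₂ : IsClosed B₂
  int_nonempty₁ : (interior B₁).Nonempty
  int_nonempty₂ : (interior B₂).Nonempty
  int_disjoint : interior B₁ ∩ interior B₂ = ∅
  inv₁ : ∀ j ∈ J, ⇑j '' B₁ = B₁
  inv₂ : ∀ j ∈ J, ⇑j '' B₂ = B₂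
  pp₁ : ∀ g ∈ G₁, g ∉ J → ⇑g '' B₁ ⊆ interior B₂
  pp₂ : ∀ g ∈ G₂, g ∉ J → ⇑g '' B₂ ⊆ interior B₁
  lim₁ : limitSet G₁ \ limitSet J ⊆ interior B₂
  lim₂ : limitSet G₂ \ limitSet J ⊆ interior B₁

/-- `G₀` is in HNN ping-pong position with respect to `f`, `J₁`, `J₋₁`, witnessed by the
closed sets `B₁`, `Bm` (where `Bm` plays the role of `B₋₁`). -/
structure HNNPingPong (G₀ J₁ Jm : Subgroup (M ≃ₜ M)) (f : M ≃ₜ M) (B₁ Bm : Set M) :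
    Prop where
  isClosed₁ : IsClosed B₁
  isClosedm : IsClosed Bm
  int_nonempty₁ : (interior B₁).Nonempty
  int_nonemptym : (interior Bm).Nonempty
  int_disjoint : interior B₁ ∩ interior Bm = ∅
  inv₁ : ∀ j ∈ J₁, ⇑j '' B₁ = B₁
  invm : ∀ j ∈ Jm, ⇑j '' Bm = Bm
  prec₁ : ∀ g ∈ G₀, g ∉ J₁ → ⇑g '' B₁ ∩ B₁ = ∅
  precm : ∀ g ∈ G₀, g ∉ Jm → ⇑g '' Bm ∩ Bm = ∅
  cross : ∀ g ∈ G₀, ⇑g '' B₁ ∩ Bm = ∅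
  mapf : ⇑f '' ((B₁ ∪ Bm)ᶜ ∪ B₁) = interior B₁
  lim₁ : limitSet G₀ ∩ B₁ = limitSet J₁
  limm : limitSet G₀ ∩ Bm = limitSet Jm
  proper : (⋃ g ∈ G₀, ⇑g '' (B₁ ∪ Bm))ᶜ.Nonempty

/-- A letter of type `i` (`i = 0` for `G₁`, `i = 1` for `G₂`) for amalgamated free product
normal forms: an element of `G_{i+1} ∖ J`. -/
def AFPLetter (G₁ G₂ J : Subgroup (M ≃ₜ M)) (i : Fin 2) (g : M ≃ₜ M) : Prop :=
  g ∈ (if i = 0 then G₁ else G₂) ∧ g ∉ J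

/-- `h` is an `(i,j)`-form: a product of a nonempty alternating list of letters, whose first
letter lies in `G_i ∖ J` and whose last letter lies in `G_j ∖ J` (indices shifted so that
`0` stands for `G₁` and `1` for `G₂`). -/
def IsIJForm (G₁ G₂ J : Subgroup (M ≃ₜ M)) (i j : Fin 2) (h : M ≃ₜ M) : Prop :=
  ∃ l : List (M ≃ₜ M), l ≠ [] ∧ l.prod = h ∧
    (∀ g ∈ l, AFPLetter G₁ G₂ J 0 g ∨ AFPLetter G₁ G₂ J 1 g) ∧
    l.Chain' (fun a b => ∀ c : Fin 2, AFPLetter G₁ G₂ J c a → AFPLetter G₁ G₂ J (1 - c) b) ∧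
    (∀ hne : l ≠ [], AFPLetter G₁ G₂ J i (l.head hne)) ∧
    (∀ hne : l ≠ [], AFPLetter G₁ G₂ J j (l.getLast hne))

set_option linter.unusedSectionVars false

section Basics

variable {M : Type*} [MetricSpace M]

theorem mul_apply (g h : M ≃ₜ M) (x : M) : (g * h) x = g (h x) := rfl

theorem one_apply (x : M) : (1 : M ≃ₜ M) x = x := rfl

theorem inv_apply_self (g : M ≃ₜ M) (x : M) : g⁻¹ (g x) = x := g.symm_apply_apply x

theorem apply_inv_self (g : M ≃ₜ M) (x : M) : g (g⁻¹ x) = x := g.apply_symm_apply x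

theorem inv_apply_eq {g : M ≃ₜ M} {x y : M} : g⁻¹ x = y ↔ x = g y := g.symm_apply_eq

/-- Every sequence has a subsequence that is constant or injective. -/
theorem exists_strictMono_const_or_injective {α : Type*} (u : ℕ → α) :
    ∃ φ : ℕ → ℕ, StrictMono φ ∧
      ((∃ a, ∀ n, u (φ n) = a) ∨ Function.Injective (u ∘ φ)) := by
  by_cases h : ∃ a, ∃ᶠ n in atTop, u n = a
  · obtain ⟨a, ha⟩ := h
    obtain ⟨φ, hφ, h⟩ := extraction_of_frequently_atTop ha
    exact ⟨φ, hφ, Or.inl ⟨a, h⟩⟩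
  · push Not at h
    have h' : ∀ n, ∀ᶠ m in atTop, u m ≠ u n := fun n => by
      simpa using h (u n)
    have : ∀ n, ∃ N > n, ∀ m ≥ N, u m ≠ u n := fun n => by
      obtain ⟨N, hN⟩ := eventually_atTop.1 (h' n)
      exact ⟨max N (n + 1), by omega, fun m hm => hN m (le_trans (le_max_left _ _) hm)⟩
    have hev : ∀ n, ∀ᶠ k in atTop, ∀ i ≤ n, u k ≠ u i := fun n =>
      (eventually_all_finite (Set.finite_Iic n)).2 fun i _ => h' i
    obtain ⟨f, -, hf⟩ := exists_seq_of_forall_finset_exists (fun _ : ℕ => True)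
      (fun m n => m < n ∧ u n ≠ u m) (fun s _ => by
        have : ∀ᶠ k in atTop, ∀ i ∈ s, i < k ∧ u k ≠ u i :=
          (eventually_all_finset s).2 fun i _ => (eventually_gt_atTop i).and (h' i)
        obtain ⟨k, hk⟩ := this.exists
        exact ⟨k, trivial, hk⟩)
    refine ⟨f, fun m n h => (hf m n h).1, Or.inr ?_⟩
    intro m n hmn
    rcases lt_trichotomy m n with h | h | h
    · exact absurd hmn.symm (hf m n h).2
    · exact h
    · exact absurd hmn (hf n m h).2

theorem isConvSeq_iff [CompactSpace M] {g : ℕ → M ≃ₜ M} {zp zm : M} :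
    IsConvSeq g zp zm ↔ ∀ U ∈ 𝓝 zp, ∀ V ∈ 𝓝 zm, ∀ᶠ k in atTop, ∀ x, x ∈ V ∨ g k x ∈ U := by
  constructor
  · intro h U hU V hV
    filter_upwards [h (interior V)ᶜ (isOpen_interior.isClosed_compl.isCompact)
      (by simpa using mem_interior_iff_mem_nhds.2 hV) U hU] with k hk x
    by_cases hx : x ∈ V
    · exact Or.inl hx
    · exact Or.inr (hk x fun h => hx (interior_subset h))
  · intro h K hK hz U hU
    filter_upwards [h U hU Kᶜ (hK.isClosed.isOpen_compl.mem_nhds hz)] with k hk x hx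
    exact (hk x).resolve_left (by simpa using hx)

theorem IsConvSeq.comp {g : ℕ → M ≃ₜ M} {zp zm : M} (h : IsConvSeq g zp zm) {φ : ℕ → ℕ}
    (hφ : StrictMono φ) : IsConvSeq (g ∘ φ) zp zm :=
  fun K hK hz U hU => hφ.tendsto_atTop.eventually (h K hK hz U hU)

variable [CompactSpace M]

theorem IsConvSeq.tendsto_of_tendsto {g : ℕ → M ≃ₜ M} {zp zm : M} (h : IsConvSeq g zp zm)
    {x : ℕ → M} {c : M} (hx : Tendsto x atTop (𝓝 c)) (hc : c ≠ zm) :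
    Tendsto (fun k => g k (x k)) atTop (𝓝 zp) := by
  intro U hU
  obtain ⟨V, W, hV, hW, hd⟩ := t2_separation_nhds hc
  have hV' := hx.eventually_mem hV
  refine mem_map.2 ?_
  filter_upwards [isConvSeq_iff.1 h U hU W hW, hV'] with k hk hxk
  exact (hk _).resolve_left fun h => Set.disjoint_left.1 hd hxk h

theorem IsConvSeq.tendsto {g : ℕ → M ≃ₜ M} {zp zm : M} (h : IsConvSeq g zp zm)
    {x : M} (hc : x ≠ zm) : Tendsto (fun k => g k x) atTop (𝓝 zp) :=
  h.tendsto_of_tendsto tendsto_const_nhds hc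

theorem IsConvSeq.inv {g : ℕ → M ≃ₜ M} {zp zm : M} (h : IsConvSeq g zp zm) :
    IsConvSeq (fun k => (g k)⁻¹) zm zp := by
  rw [isConvSeq_iff] at h ⊢
  intro U hU V hV
  filter_upwards [h V hV U hU] with k hk x
  have := hk ((g k)⁻¹ x)
  rw [apply_inv_self] at this
  exact this.symm

theorem IsConvSeq.mul_left {g : ℕ → M ≃ₜ M} {zp zm : M} (h : IsConvSeq g zp zm)
    (a : M ≃ₜ M) : IsConvSeq (fun k => a * g k) (a zp) zm := by
  intro K hK hz U hU
  exact h K hK hz (a ⁻¹' U) (a.continuous.continuousAt hU)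

theorem IsConvSeq.mul_right {g : ℕ → M ≃ₜ M} {zp zm : M} (h : IsConvSeq g zp zm)
    (a : M ≃ₜ M) : IsConvSeq (fun k => g k * a) zp (a⁻¹ zm) := by
  intro K hK hz U hU
  filter_upwards [h (a '' K) (hK.image a.continuous) (by
    rintro ⟨y, hy, rfl⟩
    exact hz (by rwa [inv_apply_self])) U hU] with k hk x hx
  exact hk _ (mem_image_of_mem _ hx)

/-- A sequence of pairwise distinct elements of `G` that is a convergence sequence. -/
def ConvIn (G : Subgroup (M ≃ₜ M)) (g : ℕ → M ≃ₜ M) (zp zm : M) : Prop :=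
  (∀ k, g k ∈ G) ∧ Function.Injective g ∧ IsConvSeq g zp zm

namespace ConvIn

variable {G : Subgroup (M ≃ₜ M)} {g : ℕ → M ≃ₜ M} {zp zm : M}

theorem comp (h : ConvIn G g zp zm) {φ : ℕ → ℕ} (hφ : StrictMono φ) :
    ConvIn G (g ∘ φ) zp zm :=
  ⟨fun _ => h.1 _, h.2.1.comp hφ.injective, h.2.2.comp hφ⟩

theorem inv (h : ConvIn G g zp zm) : ConvIn G (fun k => (g k)⁻¹) zm zp :=
  ⟨fun k => G.inv_mem (h.1 k), fun _ _ hab => h.2.1 (inv_injective hab), h.2.2.inv⟩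

theorem mul_left (h : ConvIn G g zp zm) {a : M ≃ₜ M} (ha : a ∈ G) :
    ConvIn G (fun k => a * g k) (a zp) zm :=
  ⟨fun k => G.mul_mem ha (h.1 k), fun _ _ hab => h.2.1 (mul_left_cancel hab),
    h.2.2.mul_left a⟩

theorem tendsto (h : ConvIn G g zp zm) {x : M} (hx : x ≠ zm) :
    Tendsto (fun k => g k x) atTop (𝓝 zp) := h.2.2.tendsto hx

theorem tendsto_of_tendsto (h : ConvIn G g zp zm) {x : ℕ → M} {c : M}
    (hx : Tendsto x atTop (𝓝 c)) (hc : c ≠ zm) :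
    Tendsto (fun k => g k (x k)) atTop (𝓝 zp) := h.2.2.tendsto_of_tendsto hx hc

theorem attr_mem (h : ConvIn G g zp zm) : zp ∈ limitSet G := ⟨g, h.1, h.2.1, zm, h.2.2⟩

theorem rep_mem (h : ConvIn G g zp zm) : zm ∈ limitSet G := h.inv.attr_mem

end ConvIn

theorem mem_limitSet {G : Subgroup (M ≃ₜ M)} {x : M} :
    x ∈ limitSet G ↔ ∃ g z, ConvIn G g x z :=
  ⟨fun ⟨g, h1, h2, z, h3⟩ => ⟨g, z, h1, h2, h3⟩, fun ⟨_, _, h⟩ => h.attr_mem⟩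

theorem IsDiscreteConvGroup.exists_convIn {G : Subgroup (M ≃ₜ M)} (hG : IsDiscreteConvGroup G)
    {g : ℕ → M ≃ₜ M} (hg : ∀ k, g k ∈ G) (hi : Function.Injective g) :
    ∃ φ : ℕ → ℕ, StrictMono φ ∧ ∃ zp zm, ConvIn G (g ∘ φ) zp zm := by
  obtain ⟨φ, hφ, zp, zm, h⟩ := hG g hg hi
  exact ⟨φ, hφ, zp, zm, fun k => hg _, hi.comp hφ.injective, h⟩

theorem IsDiscreteConvGroup.mono {G H : Subgroup (M ≃ₜ M)} (hG : IsDiscreteConvGroup G)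
    (h : H ≤ G) : IsDiscreteConvGroup H := fun g hg hi => hG g (fun k => h (hg k)) hi

theorem limitSet_mono {G H : Subgroup (M ≃ₜ M)} (h : H ≤ G) : limitSet H ⊆ limitSet G :=
  fun _ ⟨g, h1, h2⟩ => ⟨g, fun k => h (h1 k), h2⟩

theorem apply_mem_limitSet {G : Subgroup (M ≃ₜ M)} {g : M ≃ₜ M} (hg : g ∈ G) {x : M}
    (hx : x ∈ limitSet G) : g x ∈ limitSet G := by
  obtain ⟨u, z, h⟩ := mem_limitSet.1 hx
  exact (h.mul_left hg).attr_mem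

theorem apply_mem_limitSet_iff {G : Subgroup (M ≃ₜ M)} {g : M ≃ₜ M} (hg : g ∈ G) {x : M} :
    g x ∈ limitSet G ↔ x ∈ limitSet G := by
  refine ⟨fun h => ?_, apply_mem_limitSet hg⟩
  have := apply_mem_limitSet (G.inv_mem hg) h
  rwa [inv_apply_self] at this

theorem ConvIn.conj {G H : Subgroup (M ≃ₜ M)} {u : ℕ → M ≃ₜ M} {zp zm : M}
    (h : ConvIn G u zp zm) {g : M ≃ₜ M} (hg : ∀ a ∈ G, g * a * g⁻¹ ∈ H) :
    ConvIn H (fun k => g * u k * g⁻¹) (g zp) (g zm) := by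
  refine ⟨fun k => hg _ (h.1 k), fun a b hab => h.2.1 ?_, ?_⟩
  · exact mul_left_cancel (mul_right_cancel hab)
  · have := (h.2.2.mul_left g).mul_right g⁻¹
    rwa [inv_inv] at this

theorem apply_mem_limitSet_of_conj {G H : Subgroup (M ≃ₜ M)} {g : M ≃ₜ M}
    (hg : ∀ a ∈ G, g * a * g⁻¹ ∈ H) {x : M} (hx : x ∈ limitSet G) : g x ∈ limitSet H := by
  obtain ⟨u, z, h⟩ := mem_limitSet.1 hx
  exact (h.conj hg).attr_mem

theorem exists_subseq_tendsto_ne {u : ℕ → M} {b : M} (h : ¬Tendsto u atTop (𝓝 b)) :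
    ∃ φ : ℕ → ℕ, StrictMono φ ∧ ∃ y, y ≠ b ∧ Tendsto (u ∘ φ) atTop (𝓝 y) := by
  obtain ⟨U, hU, hfr⟩ : ∃ U ∈ 𝓝 b, ∃ᶠ k in atTop, u k ∉ U := by
    by_contra hc
    push Not at hc
    refine h fun U hU => ?_
    have := hc U hU
    exact mem_map.2 (by simpa using this)
  obtain ⟨φ, hφ, hφU⟩ := extraction_of_frequently_atTop hfr
  obtain ⟨y, -, ψ, hψ, hy⟩ := isCompact_univ.tendsto_subseq (fun n => mem_univ (u (φ n)))
  refine ⟨φ ∘ ψ, hφ.comp hψ, y, ?_, hy⟩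
  rintro rfl
  obtain ⟨k, hk⟩ := (hy.eventually_mem hU).exists
  exact hφU _ hk

/-- A space with at least three points. -/
def ThreePoints (M : Type*) : Prop := ∀ x y : M, ∃ z, z ≠ x ∧ z ≠ y

theorem exists_strictMono_injective_mem {α : Type*} {S : ℕ → Set α} (hS : ∀ n, (S n).Infinite) :
    ∃ (φ : ℕ → ℕ) (a : ℕ → α), StrictMono φ ∧ Function.Injective a ∧ ∀ k, a k ∈ S (φ k) := by
  classical
  obtain ⟨u, hu1, hu2⟩ := exists_seq_of_forall_finset_exists (fun q : ℕ × α => q.2 ∈ S q.1)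
    (fun p q => p.1 < q.1 ∧ p.2 ≠ q.2) (fun s _ => by
      obtain ⟨a, ha, has⟩ := (hS (s.sup Prod.fst + 1)).exists_notMem_finset (s.image Prod.snd)
      refine ⟨(s.sup Prod.fst + 1, a), ha, fun q hq => ⟨?_, fun h => has ?_⟩⟩
      · exact Nat.lt_succ_of_le (Finset.le_sup (f := Prod.fst) hq)
      · exact Finset.mem_image.2 ⟨q, hq, h⟩)
  refine ⟨fun k => (u k).1, fun k => (u k).2, fun m n h => (hu2 m n h).1, fun m n hmn => ?_, hu1⟩
  rcases lt_trichotomy m n with h | h | h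
  · exact absurd hmn (hu2 m n h).2
  · exact h
  · exact absurd hmn.symm (hu2 n m h).2

theorem isClosed_limitSet {G : Subgroup (M ≃ₜ M)} (hG : IsDiscreteConvGroup G)
    (h3 : ThreePoints M) : IsClosed (limitSet G) := by
  refine IsSeqClosed.isClosed ?_
  intro x p hx hp
  choose g z h using fun n => mem_limitSet.1 (hx n)
  obtain ⟨w, -, φ, hφ, hw⟩ := isCompact_univ.tendsto_subseq (fun n => mem_univ (z n))
  have hinf : ∀ n : ℕ, {a | a ∈ G ∧ ∀ y, y ∈ Metric.ball (z (φ n)) (1 / ((n : ℝ) + 1)) ∨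
      a y ∈ Metric.ball (x (φ n)) (1 / ((n : ℝ) + 1))}.Infinite := by
    intro n
    have e1 := isConvSeq_iff.1 (h (φ n)).2.2 _ (Metric.ball_mem_nhds (x (φ n))
      (ε := 1 / ((n : ℝ) + 1)) (by positivity))
      _ (Metric.ball_mem_nhds (z (φ n)) (ε := 1 / ((n : ℝ) + 1)) (by positivity))
    obtain ⟨N, hN⟩ := eventually_atTop.1 e1
    refine Set.infinite_of_injective_forall_mem
      ((h (φ n)).2.1.comp (add_left_injective N)) (fun k => ⟨(h (φ n)).1 _, ?_⟩)
    exact hN (k + N) (by omega)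
  obtain ⟨ψ, a, hψ, hinj, ha⟩ := exists_strictMono_injective_mem hinf
  obtain ⟨θ, hθ, α, β, hc⟩ := hG.exists_convIn (fun k => (ha k).1) hinj
  obtain ⟨c, hcw, hcβ⟩ := h3 w β
  have t0 : Tendsto (fun k => (1 : ℝ) / ((ψ (θ k) : ℝ) + 1)) atTop (𝓝 0) :=
    tendsto_one_div_add_atTop_nhds_zero_nat.comp (hψ.comp hθ).tendsto_atTop
  have t1 : Tendsto (fun k => z (φ (ψ (θ k)))) atTop (𝓝 w) :=
    hw.comp (hψ.comp hθ).tendsto_atTop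
  have t2 : Tendsto (fun k => x (φ (ψ (θ k)))) atTop (𝓝 p) :=
    hp.comp (hφ.comp (hψ.comp hθ)).tendsto_atTop
  have t3 := hc.tendsto hcβ
  have e : ∀ᶠ k in atTop, (1 : ℝ) / ((ψ (θ k) : ℝ) + 1) < dist c (z (φ (ψ (θ k)))) :=
    t0.eventually_lt (tendsto_const_nhds.dist t1) (dist_pos.2 hcw)
  have t4 : Tendsto (fun k => dist ((a ∘ θ) k c) (x (φ (ψ (θ k))))) atTop (𝓝 0) := by
    refine squeeze_zero' (Eventually.of_forall fun _ => dist_nonneg) ?_ t0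
    filter_upwards [e] with k hk
    have := ((ha (θ k)).2 c).resolve_left (fun hmem => absurd (Metric.mem_ball.1 hmem) hk.not_gt)
    exact (Metric.mem_ball.1 this).le
  have := tendsto_nhds_unique t4 (t3.dist t2)
  have : α = p := dist_eq_zero.1 this.symm
  exact this ▸ hc.attr_mem

theorem isConicalLimitPt_of_convIn_same {G : Subgroup (M ≃ₜ M)} {g : ℕ → M ≃ₜ M} {b x y : M}
    (h : ConvIn G g b x) (hx : Tendsto (fun k => g k x) atTop (𝓝 y)) (hy : y ≠ b) :
    IsConicalLimitPt G x := by
  refine ⟨g, h.1, h.2.1, fun z hz => ?_⟩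
  have ht : Tendsto (fun k => (g k x, g k z)) atTop (𝓝 (y, b)) := hx.prodMk_nhds (h.tendsto hz)
  refine ⟨_, ht.isCompact_insert_range, ?_, fun k => Or.inr ⟨k, rfl⟩⟩
  rintro p (rfl | ⟨k, rfl⟩)
  · exact hy
  · exact fun he => hz ((g k).injective he).symm

theorem isConicalLimitPt_of_convIn {G : Subgroup (M ≃ₜ M)} {g : ℕ → M ≃ₜ M} {b c x y : M}
    (h : ConvIn G g b c) (hx : Tendsto (fun k => g k x) atTop (𝓝 y)) (hy : y ≠ b) :
    IsConicalLimitPt G x := by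
  by_cases hc : x = c
  · subst hc
    exact isConicalLimitPt_of_convIn_same h hx hy
  · exact absurd (tendsto_nhds_unique hx (h.tendsto hc)) hy

/-- Orbits of non-conical points converge to the attracting point, with no exception. -/
theorem ConvIn.tendsto_of_not_conical {G : Subgroup (M ≃ₜ M)} {g : ℕ → M ≃ₜ M} {b c x : M}
    (h : ConvIn G g b c) (hx : ¬IsConicalLimitPt G x) :
    Tendsto (fun k => g k x) atTop (𝓝 b) := by
  by_contra hn
  obtain ⟨φ, hφ, y, hy, ht⟩ := exists_subseq_tendsto_ne hn
  exact hx (isConicalLimitPt_of_convIn (h.comp hφ) ht hy)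

theorem IsConicalLimitPt.exists_convIn {G : Subgroup (M ≃ₜ M)} (hG : IsDiscreteConvGroup G)
    (h3 : ThreePoints M) {x : M} (hx : IsConicalLimitPt G x) :
    ∃ g a b, ConvIn G g b x ∧ Tendsto (fun k => g k x) atTop (𝓝 a) ∧ a ≠ b := by
  obtain ⟨g, hg, hi, hK⟩ := hx
  obtain ⟨φ, hφ, b, c, hc⟩ := hG.exists_convIn hg hi
  have hcx : c = x := by
    by_contra hne
    obtain ⟨z, hzx, hzc⟩ := h3 x c
    obtain ⟨K, hKc, hKd, hKm⟩ := hK z hzx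
    have ht := (hc.tendsto (Ne.symm hne)).prodMk_nhds (hc.tendsto hzc)
    have := hKc.isClosed.mem_of_tendsto ht (Eventually.of_forall fun k => hKm (φ k))
    exact hKd _ this rfl
  subst hcx
  obtain ⟨a, -, ψ, hψ, ha⟩ := isCompact_univ.tendsto_subseq (fun n => mem_univ (g (φ n) c))
  refine ⟨_, a, b, hc.comp hψ, ha, ?_⟩
  obtain ⟨z, hzx, -⟩ := h3 c c
  obtain ⟨K, hKc, hKd, hKm⟩ := hK z hzx
  have ht := ha.prodMk_nhds ((hc.comp hψ).tendsto hzx)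
  exact hKd _ (hKc.isClosed.mem_of_tendsto ht (Eventually.of_forall fun k => hKm (φ (ψ k))))

theorem IsConicalLimitPt.mem_limitSet {G : Subgroup (M ≃ₜ M)} (hG : IsDiscreteConvGroup G)
    (h3 : ThreePoints M) {x : M} (hx : IsConicalLimitPt G x) : x ∈ limitSet G := by
  obtain ⟨g, a, b, h, -⟩ := hx.exists_convIn hG h3
  exact h.rep_mem

theorem IsConicalLimitPt.mono {G H : Subgroup (M ≃ₜ M)} (h : G ≤ H) {x : M}
    (hx : IsConicalLimitPt G x) : IsConicalLimitPt H x := by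
  obtain ⟨g, hg, h2⟩ := hx
  exact ⟨g, fun k => h (hg k), h2⟩

theorem IsConicalLimitPt.apply {G : Subgroup (M ≃ₜ M)} {x : M} (hx : IsConicalLimitPt G x)
    {a : M ≃ₜ M} (ha : a ∈ G) : IsConicalLimitPt G (a x) := by
  obtain ⟨g, hg, hi, hK⟩ := hx
  refine ⟨fun k => g k * a⁻¹, fun k => G.mul_mem (hg k) (G.inv_mem ha),
    fun _ _ hab => hi (mul_right_cancel hab), fun z hz => ?_⟩
  obtain ⟨K, h1, h2, h3⟩ := hK (a⁻¹ z) (fun h => hz (inv_apply_eq.1 h))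
  refine ⟨K, h1, h2, fun k => ?_⟩
  have := h3 k
  rwa [mul_apply, mul_apply, inv_apply_self]

theorem isConicalLimitPt_apply_iff {G : Subgroup (M ≃ₜ M)} {x : M}
    {a : M ≃ₜ M} (ha : a ∈ G) : IsConicalLimitPt G (a x) ↔ IsConicalLimitPt G x := by
  refine ⟨fun h => ?_, fun h => h.apply ha⟩
  have := h.apply (G.inv_mem ha)
  rwa [inv_apply_self] at this

theorem isEllipticElem_of_isOfFinOrder {g : M ≃ₜ M} (hg : IsOfFinOrder g) : IsEllipticElem g := by
  have hfin : (Set.range fun n : ℤ => toCM (g ^ n)).Finite := by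
    have h1 : (Set.range fun n : ℤ => g ^ n).Finite := by
      have := hg.finite_zpowers
      exact this.subset (by rintro _ ⟨n, rfl⟩; exact ⟨n, rfl⟩)
    have : (Set.range fun n : ℤ => toCM (g ^ n)) = toCM '' (Set.range fun n : ℤ => g ^ n) := by
      rw [← Set.range_comp]; rfl
    rw [this]
    exact h1.image _
  refine ⟨?_, ?_⟩
  · rw [hfin.isClosed.closure_eq]
    exact hfin.isCompact
  · rw [hfin.isClosed.closure_eq]
    rintro _ ⟨n, rfl⟩
    exact ⟨_, rfl⟩

theorem mem_of_pow_apply {p : M ≃ₜ M} {V : Set M} (h : ∀ y ∈ V, p y ∈ V) (n : ℕ) {y : M}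
    (hy : y ∈ V) : (p ^ n) y ∈ V := by
  induction n with
  | zero => exact hy
  | succ n ih => rw [pow_succ', mul_apply]; exact h _ ih

theorem exists_tendsto_pow_of_unique_fixed {G : Subgroup (M ≃ₜ M)} (hG : IsDiscreteConvGroup G)
    (h3 : ThreePoints M) {p : M ≃ₜ M} (hp : p ∈ G) (hord : ¬IsOfFinOrder p) {x : M}
    (hfix : ∀ y, p y = y ↔ y = x) :
    ∃ φ : ℕ → ℕ, StrictMono φ ∧ ConvIn G (fun n => p ^ φ n) x x := by
  have hinj : Function.Injective fun n : ℕ => p ^ n := by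
    exact injective_pow_iff_not_isOfFinOrder.2 hord
  obtain ⟨φ, hφ, α, β, h⟩ := hG.exists_convIn (fun k => G.pow_mem hp k) hinj
  have key : ∀ (q : M ≃ₜ M) (u : ℕ → M ≃ₜ M) (α β : M), (∀ y, q y = y ↔ y = x) →
      (∀ k, u k * q = q * u k) → ConvIn G u α β → α = x := by
    intro q u α β hq hcomm hu
    obtain ⟨z, hz1, hz2⟩ := h3 β (q⁻¹ β)
    have t1 := hu.tendsto hz1
    have t2 := hu.tendsto (x := q z) (fun h => hz2 (inv_apply_eq.2 h.symm).symm)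
    have t3 : Tendsto (fun k => u k (q z)) atTop (𝓝 (q α)) := by
      have := (q.continuous.tendsto α).comp t1
      refine this.congr fun k => ?_
      exact (congrArg (fun w : M ≃ₜ M => w z) (hcomm k)).symm
    exact (hq _).1 (tendsto_nhds_unique t3 t2)
  have e1 := key p _ α β hfix (fun k => ((Commute.refl p).pow_left _).eq) h
  have e2 := key p _ β α hfix (fun k => ((Commute.refl p).pow_left _).inv_left.eq) h.inv
  subst e1
  subst e2
  exact ⟨φ, hφ, h⟩

theorem not_isConicalLimitPt_of_unique_fixed {G : Subgroup (M ≃ₜ M)}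
    (hG : IsDiscreteConvGroup G) (h3 : ThreePoints M) {p : M ≃ₜ M} (hp : p ∈ G)
    (hord : ¬IsOfFinOrder p) {x : M} (hfix : ∀ y, p y = y ↔ y = x) :
    ¬IsConicalLimitPt G x := by
  intro hcon
  obtain ⟨g, a, b, hg, ha, hab⟩ := hcon.exists_convIn hG h3
  -- the repelling point of a convergence sequence of conjugates is the limit of fixed points
  have key : ∀ (q : M ≃ₜ M) (φ : ℕ → ℕ) (α β : M), q ∈ G → ¬IsOfFinOrder q →
      (∀ y, q y = y ↔ y = x) → StrictMono φ →
      ConvIn G (fun n => g (φ n) * q * (g (φ n))⁻¹) α β → β = a := by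
    intro q φ α β hq hqo hqx hφ hc
    by_contra hne
    have ta : Tendsto (fun n => g (φ n) x) atTop (𝓝 a) := ha.comp hφ.tendsto_atTop
    have hα : α = a := by
      have := hc.tendsto_of_tendsto ta (Ne.symm hne)
      refine tendsto_nhds_unique (this.congr fun k => ?_) ta
      rw [mul_apply, mul_apply, inv_apply_self, (hqx x).2 rfl]
    subst hα
    have hd : 0 < dist β α := dist_pos.2 hne
    have e1 := isConvSeq_iff.1 hc.2.2 _ (Metric.ball_mem_nhds α (half_pos hd)) _
      (Metric.closedBall_mem_nhds β (half_pos hd))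
    have e2 := ta.eventually_mem (Metric.ball_mem_nhds α (half_pos hd))
    obtain ⟨n, hn1, hn2⟩ := (e1.and e2).exists
    have hdisj : ∀ y, y ∈ Metric.closedBall β (dist β α / 2) →
        y ∈ Metric.ball α (dist β α / 2) → False := by
      intro y h1 h2
      rw [Metric.mem_closedBall] at h1
      rw [Metric.mem_ball] at h2
      have := dist_triangle_left β α y
      linarith
    set w := (g (φ n) * q * (g (φ n))⁻¹)⁻¹ with hw
    have hinv : ∀ y ∈ Metric.closedBall β (dist β α / 2),
        w y ∈ Metric.closedBall β (dist β α / 2) := by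
      intro y hy
      refine (hn1 (w y)).resolve_right fun h => ?_
      rw [hw, apply_inv_self] at h
      exact hdisj y hy h
    have hwe : w = g (φ n) * q⁻¹ * (g (φ n))⁻¹ := by rw [hw]; group
    have hwo : ¬IsOfFinOrder w := by
      intro h
      rw [hw, isOfFinOrder_inv_iff] at h
      have h' : IsOfFinOrder ((MulAut.conj (g (φ n))).toMonoidHom q) := h
      exact hqo ((MulAut.conj (g (φ n))).injective.isOfFinOrder_iff.1 h')
    have hwG : w ∈ G := by
      rw [hw]
      exact G.inv_mem (hc.1 n)
    have hwx : ∀ y, w y = y ↔ y = g (φ n) x := by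
      intro y
      rw [hw, inv_apply_eq, mul_apply, mul_apply, eq_comm]
      constructor
      · intro h
        have : q ((g (φ n))⁻¹ y) = (g (φ n))⁻¹ y := by
          rw [eq_comm, inv_apply_eq, h]
        rw [← (hqx _).1 this, apply_inv_self]
      · rintro rfl
        rw [inv_apply_self, (hqx x).2 rfl]
    obtain ⟨ψ, hψ, hcw⟩ := exists_tendsto_pow_of_unique_fixed hG h3 hwG hwo hwx
    have hβ : β ∈ Metric.closedBall β (dist β α / 2) := Metric.mem_closedBall_self (half_pos hd).le
    have := Metric.isClosed_closedBall.mem_of_tendsto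
      (hcw.tendsto (x := β) (fun h => hdisj β hβ (h ▸ hn2)))
      (Eventually.of_forall fun k => mem_of_pow_apply hinv (ψ k) hβ)
    exact hdisj _ this hn2
  obtain ⟨φ, hφ, ⟨w, hw⟩ | hinj⟩ :=
    exists_strictMono_const_or_injective fun n => g n * p * (g n)⁻¹
  · set c : ℕ → M ≃ₜ M := fun n => (g (φ 0))⁻¹ * g (φ n) with hcdef
    have hcomm : ∀ n y, p (c n y) = c n (p y) := by
      intro n y
      have h1 : g (φ n) * p * (g (φ n))⁻¹ = g (φ 0) * p * (g (φ 0))⁻¹ := (hw n).trans (hw 0).symm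
      have h2 : p * c n = c n * p := by
        calc p * c n = (g (φ 0))⁻¹ * (g (φ 0) * p * (g (φ 0))⁻¹) * g (φ n) := by
              rw [hcdef]; group
          _ = c n * p := by rw [← h1, hcdef]; group
      exact congrArg (fun w : M ≃ₜ M => w y) h2
    have hcx : ∀ n, c n x = x := fun n => (hfix _).1 (by rw [hcomm, (hfix x).2 rfl])
    have hgx : ∀ n, g (φ n) x = g (φ 0) x := fun n => (inv_apply_eq.1 (hcx n))
    have ha' : a = g (φ 0) x := by
      refine tendsto_nhds_unique (ha.comp hφ.tendsto_atTop) ?_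
      exact tendsto_const_nhds.congr fun n => (hgx n).symm
    obtain ⟨z, hz, -⟩ := h3 x x
    have t : ∀ y, y ≠ x → Tendsto (fun n => c n y) atTop (𝓝 ((g (φ 0))⁻¹ b)) := fun y hy =>
      ((g (φ 0))⁻¹.continuous.tendsto b).comp ((hg.comp hφ).tendsto hy)
    have hpz : p z ≠ x := fun h => hz (p.injective (h.trans ((hfix x).2 rfl).symm))
    have h1 := (p.continuous.tendsto _).comp (t z hz)
    have h2 := tendsto_nhds_unique (h1.congr fun n => hcomm n z) (t (p z) hpz)
    have h4 := inv_apply_eq.1 ((hfix _).1 h2)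
    exact hab (ha'.trans h4.symm)
  · obtain ⟨ψ, hψ, α, β, hc⟩ := hG.exists_convIn
      (fun k => G.mul_mem (G.mul_mem (hg.1 (φ k)) hp) (G.inv_mem (hg.1 (φ k)))) hinj
    have e1 := key p _ α β hp hord hfix (hφ.comp hψ) hc
    have hfix' : ∀ y, p⁻¹ y = y ↔ y = x := fun y => by rw [inv_apply_eq, eq_comm, hfix]
    have e2 := key p⁻¹ _ β α (G.inv_mem hp) (by rwa [isOfFinOrder_inv_iff]) hfix' (hφ.comp hψ)
      (by
        have := hc.inv
        convert this using 2 with n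
        simp [mul_assoc])
    subst e1
    subst e2
    obtain ⟨z, hz, -⟩ := h3 x x
    have hpz : p⁻¹ z ≠ x := fun h => hz (by rw [inv_apply_eq.1 h, (hfix x).2 rfl])
    have hgc := hg.comp (hφ.comp hψ)
    have h1 := hc.tendsto_of_tendsto (hgc.tendsto hpz) (Ne.symm hab)
    refine hab (tendsto_nhds_unique (h1.congr fun n => ?_) (hgc.tendsto hz))
    simp only [Function.comp, mul_apply, inv_apply_self, apply_inv_self]

theorem IsParabolicPt.exists_unique_fixed {G : Subgroup (M ≃ₜ M)} {x : M}
    (h : IsParabolicPt G x) : ∃ p ∈ G, ¬IsOfFinOrder p ∧ ∀ y, p y = y ↔ y = x := by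
  obtain ⟨p, hp, ⟨he, z, hz, huniq⟩, hpx⟩ := h
  exact ⟨p, hp, fun h => he (isEllipticElem_of_isOfFinOrder h), fun y =>
    ⟨fun hy => (huniq y hy).trans (huniq x hpx).symm, fun hy => hy ▸ hpx⟩⟩

theorem IsParabolicPt.not_conical {J G : Subgroup (M ≃ₜ M)} (hJG : J ≤ G)
    (hG : IsDiscreteConvGroup G) (h3 : ThreePoints M) {x : M} (h : IsParabolicPt J x) :
    ¬IsConicalLimitPt G x := by
  obtain ⟨p, hp, ho, hf⟩ := h.exists_unique_fixed
  exact not_isConicalLimitPt_of_unique_fixed hG h3 (hJG hp) ho hf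

theorem IsParabolicPt.mono {J G : Subgroup (M ≃ₜ M)} (hJG : J ≤ G) {x : M}
    (h : IsParabolicPt J x) : IsParabolicPt G x := by
  obtain ⟨p, hp, h⟩ := h
  exact ⟨p, hJG hp, h⟩

theorem IsEllipticElem.of_conj {p a : M ≃ₜ M} (h : IsEllipticElem (a * p * a⁻¹)) :
    IsEllipticElem p := by
  set Φ : C(M, M) → C(M, M) := fun F => ((toCM a⁻¹).comp F).comp (toCM a) with hΦ
  have hc : Continuous Φ :=
    (ContinuousMap.continuous_precomp (toCM a)).comp (ContinuousMap.continuous_postcomp (toCM a⁻¹))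
  have hΦt : ∀ u : M ≃ₜ M, Φ (toCM u) = toCM (a⁻¹ * u * a) := fun u => rfl
  have hsub : closure (Set.range fun n : ℤ => toCM (p ^ n)) ⊆
      Φ '' closure (Set.range fun n : ℤ => toCM ((a * p * a⁻¹) ^ n)) := by
    refine closure_minimal ?_ (h.1.image hc).isClosed
    rintro _ ⟨n, rfl⟩
    refine ⟨_, subset_closure ⟨n, rfl⟩, ?_⟩
    rw [hΦt, conj_zpow]
    congr 1
    group
  refine ⟨(h.1.image hc).of_isClosed_subset isClosed_closure hsub, fun F hF => ?_⟩
  obtain ⟨K, hK, rfl⟩ := hsub hF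
  obtain ⟨u, rfl⟩ := h.2 hK
  exact ⟨_, (hΦt u).symm⟩

theorem IsParabolicPt.apply {G : Subgroup (M ≃ₜ M)} {x : M} (h : IsParabolicPt G x)
    {a : M ≃ₜ M} (ha : a ∈ G) : IsParabolicPt G (a x) := by
  obtain ⟨p, hp, ⟨he, z, hz, huniq⟩, hpx⟩ := h
  refine ⟨a * p * a⁻¹, G.mul_mem (G.mul_mem ha hp) (G.inv_mem ha),
    ⟨fun h => he h.of_conj, a z, ?_, fun y hy => ?_⟩, ?_⟩
  · simp only [mul_apply, inv_apply_self]
    rw [hz]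
  · have : p (a⁻¹ y) = a⁻¹ y := by
      rw [eq_comm, inv_apply_eq]
      exact hy.symm
    rw [← huniq _ this, apply_inv_self]
  · simp only [mul_apply, inv_apply_self, hpx]

theorem IsBoundedParabolicPt.apply {G : Subgroup (M ≃ₜ M)} {x : M}
    (h : IsBoundedParabolicPt G x) {a : M ≃ₜ M} (ha : a ∈ G) :
    IsBoundedParabolicPt G (a x) := by
  obtain ⟨h1, K, hK, hKs, hcov⟩ := h
  refine ⟨h1.apply ha, a '' K, hK.image a.continuous, ?_, ?_⟩
  · rintro _ ⟨y, hy, rfl⟩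
    exact ⟨apply_mem_limitSet ha (hKs hy).1, fun h => (hKs hy).2 (a.injective h)⟩
  · rintro y ⟨hy1, hy2⟩
    obtain ⟨u, hu, hux, huK⟩ := hcov (a⁻¹ y)
      ⟨apply_mem_limitSet (G.inv_mem ha) hy1, fun h => hy2 (inv_apply_eq.1 h)⟩
    refine ⟨a * u * a⁻¹, G.mul_mem (G.mul_mem ha hu) (G.inv_mem ha), ?_, ?_⟩
    · simp only [mul_apply, inv_apply_self, hux]
    · exact ⟨_, huK, rfl⟩

end Basics

section Transversal

variable {M : Type*} [MetricSpace M] [CompactSpace M]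

/-- A family of pairs of points is collapsed by every convergence sequence of `J`: no limit
point of `J` is approached simultaneously by both members of pairs of the family. -/
def Collapses (J : Subgroup (M ≃ₜ M)) (Q : Set (M × M)) : Prop :=
  ∀ z ∈ limitSet J, ∃ U ∈ 𝓝 z, ∀ q ∈ Q, q.1 ∉ U ∨ q.2 ∉ U

theorem Collapses.union {J : Subgroup (M ≃ₜ M)} {Q R : Set (M × M)} (hQ : Collapses J Q)
    (hR : Collapses J R) : Collapses J (Q ∪ R) := by
  intro z hz
  obtain ⟨U, hU, h1⟩ := hQ z hz
  obtain ⟨V, hV, h2⟩ := hR z hz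
  refine ⟨U ∩ V, inter_mem hU hV, ?_⟩
  rintro q (hq | hq)
  · exact (h1 q hq).imp (fun h h' => h h'.1) (fun h h' => h h'.1)
  · exact (h2 q hq).imp (fun h h' => h h'.2) (fun h h' => h h'.2)

theorem collapses_dist (J : Subgroup (M ≃ₜ M)) {ε : ℝ} (hε : 0 < ε) :
    Collapses J {q | ε ≤ dist q.1 q.2} := by
  intro z _
  refine ⟨Metric.ball z (ε / 2), Metric.ball_mem_nhds z (half_pos hε), fun q hq => ?_⟩
  by_contra! h
  have h1 := Metric.mem_ball.1 h.1
  have h2 := Metric.mem_ball.1 h.2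
  have := dist_triangle_right q.1 q.2 z
  have hq' : ε ≤ dist q.1 q.2 := hq
  linarith

theorem collapses_diag {J : Subgroup (M ≃ₜ M)} {s : Set M}
    (hs : s.Finite) (hsd : ∀ y ∈ s, y ∉ limitSet J) :
    Collapses J ((fun y => (y, y)) '' s) := by
  intro z hz
  refine ⟨sᶜ, hs.isClosed.isOpen_compl.mem_nhds fun h => hsd z h hz, ?_⟩
  rintro _ ⟨y, hy, rfl⟩
  exact Or.inl fun h => h hy

theorem Collapses.eventually {J : Subgroup (M ≃ₜ M)} {Q : Set (M × M)} (hQ : Collapses J Q)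
    {h : ℕ → M ≃ₜ M} {zp zm : M} (hc : ConvIn J h zp zm) {V : Set M} (hV : V ∈ 𝓝 zp) :
    ∀ᶠ k in atTop, ∀ q ∈ Q, h k q.1 ∈ V ∨ h k q.2 ∈ V := by
  obtain ⟨U, hU, h1⟩ := hQ zm hc.rep_mem
  filter_upwards [isConvSeq_iff.1 hc.2.2 V hV U hU] with k hk q hq
  exact (h1 q hq).imp (hk _).resolve_left (hk _).resolve_left

theorem finite_of_collapses {J : Subgroup (M ≃ₜ M)} (hJ : IsDiscreteConvGroup J) {o : M}
    (ho : ¬IsConicalLimitPt J o) {A A' : Set M} (hA : IsClosed A) (hA' : IsOpen A')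
    (hAA' : A ⊆ A') {Q : Set (M × M)} (hQ : Collapses J Q) :
    {g : M ≃ₜ M | g ∈ J ∧ g o ∉ A' ∧ ∃ q ∈ Q, g q.1 ∈ A ∧ g q.2 ∈ A}.Finite := by
  by_contra hinf
  have u := (show Set.Infinite _ from hinf).natEmbedding
  obtain ⟨φ, hφ, zp, zm, hc⟩ := hJ.exists_convIn (g := fun k => (u k : M ≃ₜ M))
    (fun k => (u k).2.1) (Subtype.val_injective.comp u.injective)
  have h1 := hA'.isClosed_compl.mem_of_tendsto (hc.tendsto_of_not_conical ho)
    (Eventually.of_forall fun k => (u (φ k)).2.2.1)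
  obtain ⟨k, hk⟩ := (hQ.eventually hc (hA.isOpen_compl.mem_nhds fun h => h1 (hAA' h))).exists
  obtain ⟨q, hq, hq1, hq2⟩ := (u (φ k)).2.2.2
  exact (hk q hq).elim (fun h => h hq1) (fun h => h hq2)

/-- A class of separating annuli: a pair of families of sets, whose translates by `J` that
separate `o` from a collapsing family of pairs are finite in number. -/
def GoodClass (J : Subgroup (M ≃ₜ M)) (o : M) (A A' : ℕ → Set M) : Prop :=
  (∀ r, A r ⊆ A' r) ∧ ∀ Q, Collapses J Q →
    {e : ℕ × (M ≃ₜ M) | e.2 ∈ J ∧ e.2 o ∉ A' e.1 ∧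
      ∃ q ∈ Q, e.2 q.1 ∈ A e.1 ∧ e.2 q.2 ∈ A e.1}.Finite

/-- A class provides arbitrarily long nested chains of annuli separating `o` from points of
the sequence `y`, uniformly after translation. -/
def Wins (J : Subgroup (M ≃ₜ M)) (o : M) (A A' : ℕ → Set M) (y : ℕ → M) : Prop :=
  ∃ ε > 0, ∀ N : ℕ, ∃ k, ∃ h ∈ J, ∃ E : Finset (ℕ × (M ≃ₜ M)), N ≤ E.card ∧
    (∀ e ∈ E, e.2 ∈ J ∧ e.2 o ∉ A' e.1) ∧
    (∀ e ∈ E, ∀ e' ∈ E, e ≠ e' → (∀ x, e.2 x ∈ A' e.1 → e'.2 x ∈ A e'.1) ∨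
      (∀ x, e'.2 x ∈ A' e'.1 → e.2 x ∈ A e.1)) ∧
    (∀ e ∈ E, ∀ x, dist (h x) (h (y k)) < ε → e.2 x ∈ A e.1) ∧
    (∀ e ∈ E, ∃ x, e.2 x ∈ A e.1 ∧ ε ≤ dist (h x) (h (y k)))

theorem goodClass_ball {J : Subgroup (M ≃ₜ M)} (hJ : IsDiscreteConvGroup J) {o : M}
    (ho : ¬IsConicalLimitPt J o) (d : M) {ρ : ℝ} (hρ : 0 < ρ) :
    GoodClass J o (fun r => if r = 0 then Metric.closedBall d ρ else ∅)
      (fun r => if r = 0 then Metric.ball d (2 * ρ) else ∅) := by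
  have hsub : Metric.closedBall d ρ ⊆ Metric.ball d (2 * ρ) :=
    Metric.closedBall_subset_ball (by linarith)
  refine ⟨fun r => ?_, fun Q hQ => ?_⟩
  · by_cases hr : r = 0 <;> simp [hr, hsub]
  · refine ((finite_of_collapses hJ ho Metric.isClosed_closedBall Metric.isOpen_ball hsub
      hQ).image (fun g => ((0 : ℕ), g))).subset ?_
    rintro ⟨r, g⟩ ⟨h1, h2, q, hq, h3, h4⟩
    by_cases hr : r = 0
    · subst hr
      exact ⟨g, ⟨h1, by simpa using h2, q, hq, by simpa using h3, by simpa using h4⟩, rfl⟩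
    · simp [hr] at h3

theorem wins_of_conical {J : Subgroup (M ≃ₜ M)} {o : M} (ho : ¬IsConicalLimitPt J o)
    {j : ℕ → M ≃ₜ M} {a b ξ : M} (hj : ConvIn J j b ξ)
    (ha : Tendsto (fun k => j k ξ) atTop (𝓝 a)) {d : M} {ρ : ℝ} (hρ : 0 < ρ)
    (hda : dist a d < ρ) (hab : 3 * ρ < dist a b) {y : ℕ → M} (hy : Tendsto y atTop (𝓝 ξ))
    (hyξ : ∀ k, y k ≠ ξ) :
    Wins J o (fun r => if r = 0 then Metric.closedBall d ρ else ∅)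
      (fun r => if r = 0 then Metric.ball d (2 * ρ) else ∅) y := by
  classical
  have hdb : 2 * ρ < dist b d := by
    have := dist_triangle_right a b d
    linarith
  have hU : ∀ᶠ z in 𝓝 b, 2 * ρ < dist z d :=
    (continuous_id.dist continuous_const).continuousAt.eventually (lt_mem_nhds hdb)
  have ev0 : ∀ᶠ n in atTop, j n o ∉ Metric.ball d (2 * ρ) ∧ j n ξ ∈ Metric.ball d ρ := by
    filter_upwards [(hj.tendsto_of_not_conical ho).eventually hU,
      ha.eventually_mem (Metric.isOpen_ball.mem_nhds (Metric.mem_ball.2 hda))] with n h1 h2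
    exact ⟨fun h => absurd (Metric.mem_ball.1 h) h1.not_gt, h2⟩
  have ev1 : ∀ n, j n ξ ∈ Metric.ball d ρ → ∀ᶠ m in atTop, ∀ x,
      j m x ∈ Metric.ball d (2 * ρ) → j n x ∈ Metric.closedBall d ρ := by
    intro n hn
    filter_upwards [isConvSeq_iff.1 hj.2.2 _ hU _
      ((j n).continuous.continuousAt.preimage_mem_nhds (Metric.isOpen_ball.mem_nhds hn))]
      with m hm x hx
    rcases hm x with h | h
    · exact Metric.ball_subset_closedBall h
    · exact absurd (Metric.mem_ball.1 hx) (not_lt.2 (le_of_lt h))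
  obtain ⟨f, hf1, hf2⟩ := exists_seq_of_forall_finset_exists
    (fun n => j n o ∉ Metric.ball d (2 * ρ) ∧ j n ξ ∈ Metric.ball d ρ)
    (fun n m => n < m ∧ ∀ x, j m x ∈ Metric.ball d (2 * ρ) → j n x ∈ Metric.closedBall d ρ)
    (fun s hs => by
      have : ∀ᶠ m in atTop, ∀ n ∈ s, n < m ∧ ∀ x, j m x ∈ Metric.ball d (2 * ρ) →
          j n x ∈ Metric.closedBall d ρ :=
        (eventually_all_finset s).2 fun n hn => (eventually_gt_atTop n).and (ev1 n (hs n hn).2)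
      exact (ev0.and this).exists)
  have hfinj : Function.Injective f := (strictMono_nat_of_lt_succ fun n =>
    (hf2 n (n + 1) (Nat.lt_succ_self n)).1).injective
  refine ⟨ρ, hρ, fun N => ?_⟩
  -- a common second point
  have evx : ∀ᶠ k in atTop, ∀ i ∈ Finset.range N, j (f i) (y k) ∈ Metric.ball d ρ :=
    (eventually_all_finset _).2 fun i _ =>
      (((j (f i)).continuous.tendsto ξ).comp hy).eventually_mem
        (Metric.isOpen_ball.mem_nhds (hf1 i).2)
  obtain ⟨k', hk'⟩ := evx.exists
  have evm : ∀ᶠ m in atTop, ∀ i ∈ Finset.range N, ∀ x, j m x ∈ Metric.ball d (2 * ρ) →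
      j (f i) x ∈ Metric.closedBall d ρ :=
    (eventually_all_finset _).2 fun i _ => ev1 _ (hf1 i).2
  obtain ⟨m, hm1, hm2, hm3⟩ := (evm.and (ev0.and
    ((hj.tendsto (hyξ k')).eventually hU))).exists
  have evk : ∀ᶠ k in atTop, j m (y k) ∈ Metric.ball d ρ :=
    (((j m).continuous.tendsto ξ).comp hy).eventually_mem (Metric.isOpen_ball.mem_nhds hm2.2)
  obtain ⟨k, hk⟩ := evk.exists
  have hk' := hk'
  rw [Metric.mem_ball] at hk
  refine ⟨k, j m, hj.1 m, (Finset.range N).image fun i => (0, j (f i)), ?_, ?_, ?_, ?_, ?_⟩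
  · rw [Finset.card_image_of_injective, Finset.card_range]
    intro i i' h
    exact hfinj (hj.2.1 (Prod.ext_iff.1 h).2)
  · intro e he
    obtain ⟨i, hi, rfl⟩ := Finset.mem_image.1 he
    exact ⟨hj.1 _, by simpa using (hf1 i).1⟩
  · intro e he e' he' hne
    obtain ⟨i, hi, rfl⟩ := Finset.mem_image.1 he
    obtain ⟨i', hi', rfl⟩ := Finset.mem_image.1 he'
    rcases lt_trichotomy i i' with h | rfl | h
    · right
      intro x hx
      simpa using (hf2 i i' h).2 x (by simpa using hx)
    · exact absurd rfl hne
    · left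
      intro x hx
      simpa using (hf2 i' i h).2 x (by simpa using hx)
  · intro e he x hx
    obtain ⟨i, hi, rfl⟩ := Finset.mem_image.1 he
    have : j m x ∈ Metric.ball d (2 * ρ) := by
      rw [Metric.mem_ball]
      have := dist_triangle (j m x) (j m (y k)) d
      linarith
    simpa using hm1 i hi x this
  · intro e he
    obtain ⟨i, hi, rfl⟩ := Finset.mem_image.1 he
    refine ⟨y k', by simpa using Metric.ball_subset_closedBall (hk' i hi), ?_⟩
    have := dist_triangle (j m (y k')) (j m (y k)) d
    linarith

theorem finite_stabilizer_of_not_conical {J : Subgroup (M ≃ₜ M)} (hJ : IsDiscreteConvGroup J)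
    {ξ : M} (hξ : ¬IsConicalLimitPt J ξ) {δ η : ℝ} (hδ : 0 < δ) (hη : 0 < η) :
    {p : M ≃ₜ M | p ∈ J ∧ p ξ = ξ ∧ ∃ x, δ ≤ dist x ξ ∧ η ≤ dist (p x) ξ}.Finite := by
  by_contra hinf
  have u := (show Set.Infinite _ from hinf).natEmbedding
  obtain ⟨φ, hφ, zp, zm, hc⟩ := hJ.exists_convIn (g := fun k => (u k : M ≃ₜ M))
    (fun k => (u k).2.1) (Subtype.val_injective.comp u.injective)
  have e1 : ξ = zp := by
    refine tendsto_nhds_unique ?_ (hc.tendsto_of_not_conical hξ)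
    exact tendsto_const_nhds.congr fun k => (u (φ k)).2.2.1.symm
  have e2 : ξ = zm := by
    refine tendsto_nhds_unique ?_ (hc.inv.tendsto_of_not_conical hξ)
    exact tendsto_const_nhds.congr fun k =>
      (show ((u (φ k) : M ≃ₜ M))⁻¹ ξ = ξ from inv_apply_eq.2 (u (φ k)).2.2.1.symm).symm
  subst e1
  subst e2
  obtain ⟨k, hk⟩ := (isConvSeq_iff.1 hc.2.2 _ (Metric.ball_mem_nhds ξ hη) _
    (Metric.ball_mem_nhds ξ hδ)).exists
  obtain ⟨x, hx1, hx2⟩ := (u (φ k)).2.2.2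
  rcases hk x with h | h
  · exact absurd (Metric.mem_ball.1 h) hx1.not_gt
  · exact absurd (Metric.mem_ball.1 h) hx2.not_gt

theorem exists_horoball_radii {J : Subgroup (M ≃ₜ M)} (hJ : IsDiscreteConvGroup J)
    {ξ : M} (hξ : ¬IsConicalLimitPt J ξ) :
    ∃ ρ : ℕ → ℝ, (∀ r, 0 < ρ r) ∧ StrictAnti ρ ∧ (∀ r : ℕ, ρ r ≤ 1 / ((r : ℝ) + 1)) ∧
      ∀ (r : ℕ) (p : M ≃ₜ M), p ∈ J → p ξ = ξ →
        (∃ x, 1 / ((r : ℝ) + 1) ≤ dist x ξ ∧ dist (p x) ξ ≤ ρ (r + 1)) →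
        ∀ x, 1 / ((r : ℝ) + 1) ≤ dist x ξ → dist (p x) ξ < ρ r := by
  have step : ∀ (r : ℕ) (ρ : {ρ : ℝ // 0 < ρ}), ∃ ρ' : {ρ : ℝ // 0 < ρ}, ρ'.1 < ρ.1 ∧
      ρ'.1 ≤ 1 / (((r + 1 : ℕ) : ℝ) + 1) ∧ ∀ p : M ≃ₜ M, p ∈ J → p ξ = ξ →
        (∃ x, 1 / ((r : ℝ) + 1) ≤ dist x ξ ∧ dist (p x) ξ ≤ ρ'.1) →
        ∀ x, 1 / ((r : ℝ) + 1) ≤ dist x ξ → dist (p x) ξ < ρ.1 := by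
    intro r ρ
    have hr : (0 : ℝ) < 1 / ((r : ℝ) + 1) := by positivity
    have hfin := finite_stabilizer_of_not_conical hJ hξ hr ρ.2
    have ev : ∀ᶠ t : ℝ in 𝓝[>] 0, ∀ p ∈ {p : M ≃ₜ M | p ∈ J ∧ p ξ = ξ ∧
        ∃ x, 1 / ((r : ℝ) + 1) ≤ dist x ξ ∧ ρ.1 ≤ dist (p x) ξ},
        ∀ x, 1 / ((r : ℝ) + 1) ≤ dist x ξ → t < dist (p x) ξ := by
      refine (eventually_all_finite hfin).2 fun p hp => ?_
      have hcl : IsClosed (p '' {x | 1 / ((r : ℝ) + 1) ≤ dist x ξ}) :=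
        ((isClosed_le continuous_const (continuous_id.dist continuous_const)).isCompact.image
          p.continuous).isClosed
      have hn : ξ ∉ p '' {x | 1 / ((r : ℝ) + 1) ≤ dist x ξ} := by
        rintro ⟨x, hx, hpx⟩
        have : x = ξ := p.injective (hpx.trans hp.2.1.symm)
        subst this
        have hx' : 1 / ((r : ℝ) + 1) ≤ dist x x := hx
        rw [dist_self] at hx'
        linarith
      obtain ⟨t, ht, hball⟩ := Metric.isOpen_iff.1 hcl.isOpen_compl ξ hn
      filter_upwards [Ioo_mem_nhdsGT ht] with s hs x hx
      refine hs.2.trans_le (not_lt.1 fun h => hball (Metric.mem_ball.2 h) ⟨x, hx, rfl⟩)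
    have hr' : (0 : ℝ) < 1 / (((r + 1 : ℕ) : ℝ) + 1) := by positivity
    obtain ⟨t, ht1, ht2, ht3⟩ := (ev.and (Filter.Eventually.and
      (p := fun t => t ∈ Ioo 0 ρ.1) (Ioo_mem_nhdsGT ρ.2) (Ioo_mem_nhdsGT hr'))).exists
    refine ⟨⟨t, ht2.1⟩, ht2.2, ht3.2.le, ?_⟩
    rintro p hp hpξ ⟨x, hx1, hx2⟩ z hz
    by_contra! h
    exact absurd (ht1 p ⟨hp, hpξ, z, hz, h⟩ x hx1) hx2.not_gt
  choose nx h1 h2 h3 using step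
  let ρ : ℕ → {ρ : ℝ // 0 < ρ} := fun n => Nat.rec ⟨1, one_pos⟩ (fun r ρ => nx r ρ) n
  refine ⟨fun r => (ρ r).1, fun r => (ρ r).2, strictAnti_nat_of_succ_lt fun r => h1 r (ρ r),
    fun r => ?_, fun r p => h3 r (ρ r) p⟩
  cases r with
  | zero => norm_num [ρ]
  | succ r => exact h2 r (ρ r)

end Transversal

section Transversal

variable {M : Type*} [MetricSpace M] [CompactSpace M]

theorem exists_pos_le_dist_of_isClosed {K : Set M} (hK : IsClosed K) {ξ : M} (hξ : ξ ∉ K) :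
    ∃ κ > 0, ∀ x ∈ K, κ ≤ dist x ξ := by
  obtain ⟨t, ht, hball⟩ := Metric.isOpen_iff.1 hK.isOpen_compl ξ hξ
  exact ⟨t, ht, fun x hx => not_lt.1 fun h => hball (Metric.mem_ball.2 h) hx⟩

theorem exists_uniform_dist_of_collapses {J : Subgroup (M ≃ₜ M)} (hJ : IsDiscreteConvGroup J)
    {ξ o : M} (hξL : ξ ∈ limitSet J) (ho : ¬IsConicalLimitPt J o) {K : Set M} (hK : IsClosed K)
    (hξK : ξ ∉ K) {Q : Set (M × M)} (hQ : Collapses J Q) :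
    ∃ δ > 0, ∀ g ∈ J, g o ∈ K → ∀ q ∈ Q, δ ≤ dist (g q.1) ξ ∨ δ ≤ dist (g q.2) ξ := by
  by_contra! hcon
  choose g hgJ hgK q hq hq1 hq2 using fun n : ℕ =>
    hcon (1 / ((n : ℝ) + 1)) (by positivity)
  have t : ∀ u : ℕ → M, (∀ n : ℕ, dist (u n) ξ < 1 / ((n : ℝ) + 1)) → Tendsto u atTop (𝓝 ξ) :=
    fun u hu => tendsto_iff_dist_tendsto_zero.2 (squeeze_zero (fun _ => dist_nonneg)
      (fun n => (hu n).le) tendsto_one_div_add_atTop_nhds_zero_nat)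
  have t1 := t _ hq1
  have t2 := t _ hq2
  obtain ⟨φ, hφ, ⟨w, hw⟩ | hinj⟩ := exists_strictMono_const_or_injective g
  · have hwJ : w ∈ J := hw 0 ▸ hgJ _
    obtain ⟨U, hU, h⟩ := hQ (w⁻¹ ξ) (apply_mem_limitSet (J.inv_mem hwJ) hξL)
    have s : ∀ u : ℕ → M, Tendsto (fun n => g n (u n)) atTop (𝓝 ξ) →
        ∀ᶠ n in atTop, u (φ n) ∈ U := by
      intro u hu
      have := ((w⁻¹).continuous.tendsto ξ).comp (hu.comp hφ.tendsto_atTop)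
      refine (this.congr fun n => ?_).eventually_mem hU
      simp only [Function.comp, hw, inv_apply_self]
    obtain ⟨n, hn1, hn2⟩ := ((s _ t1).and (s _ t2)).exists
    exact (h _ (hq (φ n))).elim (fun h => h hn1) (fun h => h hn2)
  · obtain ⟨ψ, hψ, zp, zm, hc⟩ := hJ.exists_convIn (g := g ∘ φ) (fun k => hgJ _) hinj
    have hz : zp ∈ K := hK.mem_of_tendsto (hc.tendsto_of_not_conical ho)
      (Eventually.of_forall fun k => hgK _)
    obtain ⟨V, W, hV, hW, hd⟩ := t2_separation_nhds (fun h : zp = ξ => hξK (h ▸ hz))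
    have hφψ := (hφ.comp hψ).tendsto_atTop
    obtain ⟨k, hk1, hk2, hk3⟩ := ((hQ.eventually hc hV).and
      (((t1.comp hφψ).eventually_mem hW).and ((t2.comp hφψ).eventually_mem hW))).exists
    rcases hk1 _ (hq (φ (ψ k))) with h | h
    · exact Set.disjoint_left.1 hd h hk2
    · exact Set.disjoint_left.1 hd h hk3

theorem goodClass_horoball {J : Subgroup (M ≃ₜ M)} (hJ : IsDiscreteConvGroup J)
    {ξ o : M} (hξL : ξ ∈ limitSet J) (ho : ¬IsConicalLimitPt J o)
    {K : Set M} (hK : IsClosed K) (hξK : ξ ∉ K)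
    (hcov : ∀ g ∈ J, ∃ p ∈ J, p ξ = ξ ∧ p (g o) ∈ K) {ρ : ℕ → ℝ} (hρ : StrictAnti ρ)
    (hρ' : ∀ (r : ℕ) (p : M ≃ₜ M), p ∈ J → p ξ = ξ →
        (∃ x, 1 / ((r : ℝ) + 1) ≤ dist x ξ ∧ dist (p x) ξ ≤ ρ (r + 1)) →
        ∀ x, 1 / ((r : ℝ) + 1) ≤ dist x ξ → dist (p x) ξ < ρ r) :
    GoodClass J o (fun r => {x | ρ r ≤ dist x ξ}) (fun r => {x | ρ (r + 1) < dist x ξ}) := by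
  have hsub : ∀ r, {x | ρ r ≤ dist x ξ} ⊆ {x | ρ (r + 1) < dist x ξ} := fun r x hx =>
    lt_of_lt_of_le (hρ (Nat.lt_succ_self r)) hx
  refine ⟨hsub, fun Q hQ => ?_⟩
  obtain ⟨δ, hδ, h1⟩ := exists_uniform_dist_of_collapses hJ hξL ho hK hξK hQ
  obtain ⟨κ, hκ, h2⟩ := exists_pos_le_dist_of_isClosed hK hξK
  obtain ⟨R, hR⟩ := eventually_atTop.1 (tendsto_one_div_add_atTop_nhds_zero_nat.eventually
    (gt_mem_nhds (lt_min hκ hδ)))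
  have hfin : ∀ r, {g : M ≃ₜ M | g ∈ J ∧ g o ∉ {x | ρ (r + 1) < dist x ξ} ∧
      ∃ q ∈ Q, g q.1 ∈ {x | ρ r ≤ dist x ξ} ∧ g q.2 ∈ {x | ρ r ≤ dist x ξ}}.Finite := fun r =>
    finite_of_collapses hJ ho
      (isClosed_le continuous_const (continuous_id.dist continuous_const))
      (isOpen_lt continuous_const (continuous_id.dist continuous_const)) (hsub r) hQ
  refine (Set.Finite.biUnion (Set.finite_Iio R)
    (fun r _ => (hfin r).image (fun g => (r, g)))).subset ?_
  rintro ⟨r, g⟩ ⟨hgJ, hgo, q, hq, hq1, hq2⟩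
  simp only [mem_iUnion]
  refine ⟨r, ?_, g, ⟨hgJ, hgo, q, hq, hq1, hq2⟩, rfl⟩
  by_contra hr
  have hr' := (hR r (not_lt.1 hr)).le
  obtain ⟨p, hp, hpξ, hpK⟩ := hcov g hgJ
  have hmain := hρ' r p⁻¹ (J.inv_mem hp) (inv_apply_eq.2 hpξ.symm)
    ⟨p (g o), (hr'.trans (min_le_left _ _)).trans (h2 _ hpK), by
      rw [inv_apply_self]; exact not_lt.1 hgo⟩
  rcases h1 (p * g) (J.mul_mem hp hgJ) hpK q hq with h | h
  · have := hmain _ ((hr'.trans (min_le_right _ _)).trans h)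
    rw [mul_apply, inv_apply_self] at this
    exact absurd this (not_lt.2 hq1)
  · have := hmain _ ((hr'.trans (min_le_right _ _)).trans h)
    rw [mul_apply, inv_apply_self] at this
    exact absurd this (not_lt.2 hq2)

theorem wins_of_cocompact {J : Subgroup (M ≃ₜ M)} (hJ : IsDiscreteConvGroup J)
    (h3 : ThreePoints M) {ξ o : M} (hξ : ¬IsConicalLimitPt J ξ) (hoξ : o ≠ ξ)
    {K : Set M} (hK : IsClosed K) (hξK : ξ ∉ K) {ρ : ℕ → ℝ} (hρ0 : ∀ r, 0 < ρ r)
    (hρ : StrictAnti ρ) (hρ1 : ∀ r : ℕ, ρ r ≤ 1 / ((r : ℝ) + 1))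
    {y : ℕ → M} (hy : Tendsto y atTop (𝓝 ξ))
    (hcov : ∀ k, ∃ p ∈ J, p ξ = ξ ∧ p (y k) ∈ K) :
    Wins J o (fun r => {x | ρ r ≤ dist x ξ}) (fun r => {x | ρ (r + 1) < dist x ξ}) y := by
  classical
  choose p hpJ hpξ hpK using hcov
  obtain ⟨κ, hκ, h2⟩ := exists_pos_le_dist_of_isClosed hK hξK
  obtain ⟨u, huξ, -⟩ := h3 ξ ξ
  obtain ⟨v, hvξ, hvu⟩ := h3 ξ u
  have hε : 0 < min (κ / 2) (dist u v / 2) :=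
    lt_min (half_pos hκ) (half_pos (dist_pos.2 hvu.symm))
  have hev : 0 < min (κ / 2) (min (dist u ξ) (dist v ξ)) :=
    lt_min (half_pos hκ) (lt_min (dist_pos.2 huξ) (dist_pos.2 hvξ))
  obtain ⟨R, hR⟩ := eventually_atTop.1 (tendsto_one_div_add_atTop_nhds_zero_nat.eventually
    (gt_mem_nhds hev))
  have hR' : ∀ r ≥ R, ρ r ≤ κ / 2 ∧ ρ r ≤ dist u ξ ∧ ρ r ≤ dist v ξ := by
    intro r hr
    have := ((hρ1 r).trans (hR r hr).le)
    exact ⟨this.trans (min_le_left _ _), (this.trans (min_le_right _ _)).trans (min_le_left _ _),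
      (this.trans (min_le_right _ _)).trans (min_le_right _ _)⟩
  refine ⟨min (κ / 2) (dist u v / 2), hε, fun N => ?_⟩
  have hfin := finite_stabilizer_of_not_conical hJ hξ (dist_pos.2 hoξ) (hρ0 (R + N))
  obtain ⟨k, hk⟩ : ∃ k, dist (p k o) ξ < ρ (R + N) := by
    by_contra! hall
    have hcl : IsClosed (⋃ q ∈ {q : M ≃ₜ M | q ∈ J ∧ q ξ = ξ ∧
        ∃ x, dist o ξ ≤ dist x ξ ∧ ρ (R + N) ≤ dist (q x) ξ}, q ⁻¹' K) :=
      hfin.isClosed_biUnion fun q _ => hK.preimage q.continuous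
    have hmem := hcl.mem_of_tendsto hy (Eventually.of_forall fun k => mem_iUnion₂.2
      ⟨p k, ⟨hpJ k, hpξ k, o, le_rfl, hall k⟩, hpK k⟩)
    obtain ⟨q, hq, hqK⟩ := mem_iUnion₂.1 hmem
    have hqK' : q ξ ∈ K := hqK
    rw [hq.2.1] at hqK'
    exact hξK hqK'
  refine ⟨k, p k, hpJ k, (Finset.range N).image fun i => (R + i, p k), ?_, ?_, ?_, ?_, ?_⟩
  · rw [Finset.card_image_of_injective, Finset.card_range]
    intro i i' h
    exact Nat.add_left_cancel (Prod.ext_iff.1 h).1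
  · intro e he
    obtain ⟨i, hi, rfl⟩ := Finset.mem_image.1 he
    refine ⟨hpJ k, not_lt.2 (hk.le.trans (hρ.antitone ?_))⟩
    have := Finset.mem_range.1 hi
    show R + i + 1 ≤ R + N
    omega
  · intro e he e' he' hne
    obtain ⟨i, hi, rfl⟩ := Finset.mem_image.1 he
    obtain ⟨i', hi', rfl⟩ := Finset.mem_image.1 he'
    rcases lt_trichotomy i i' with h | rfl | h
    · left
      intro x hx
      exact le_trans (hρ.antitone (show R + i + 1 ≤ R + i' by omega)) (le_of_lt hx)
    · exact absurd rfl hne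
    · right
      intro x hx
      exact le_trans (hρ.antitone (show R + i' + 1 ≤ R + i by omega)) (le_of_lt hx)
  · intro e he x hx
    obtain ⟨i, hi, rfl⟩ := Finset.mem_image.1 he
    refine (hR' (R + i) (by omega)).1.trans ?_
    have h1 := h2 _ (hpK k)
    have h4 := dist_triangle_left (p k (y k)) ξ (p k x)
    have h5 := min_le_left (κ / 2) (dist u v / 2)
    linarith
  · intro e he
    obtain ⟨i, hi, rfl⟩ := Finset.mem_image.1 he
    obtain ⟨-, hu, hv⟩ := hR' (R + i) (by omega)
    have h4 := dist_triangle_right u v (p k (y k))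
    have h5 := min_le_right (κ / 2) (dist u v / 2)
    by_cases hc : dist u v / 2 ≤ dist u (p k (y k))
    · refine ⟨(p k)⁻¹ u, ?_, ?_⟩
      · show ρ (R + i) ≤ dist (p k ((p k)⁻¹ u)) ξ
        rwa [apply_inv_self]
      · rw [apply_inv_self]
        linarith
    · refine ⟨(p k)⁻¹ v, ?_, ?_⟩
      · show ρ (R + i) ≤ dist (p k ((p k)⁻¹ v)) ξ
        rwa [apply_inv_self]
      · rw [apply_inv_self]
        linarith

theorem exists_sum_weight_le {β : Type*} {F : Set (ℕ × β)} {w : ℕ → ℝ} {n : ℕ → ℕ} {L : ℕ}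
    (hfin : ∀ l, {b | (l, b) ∈ F}.Finite)
    (hle : ∀ l ≥ L, {b | (l, b) ∈ F}.ncard ≤ n l)
    (hw : ∀ l, w l = ((2 : ℝ) ^ l * (1 + n l))⁻¹) :
    ∃ C : ℝ, ∀ T : Finset (ℕ × β), ↑T ⊆ F → ∑ e ∈ T, w e.1 ≤ C := by
  classical
  have hw0 : ∀ l, 0 ≤ w l := fun l => by rw [hw]; positivity
  set a : ℕ → ℝ := fun l => ({b | (l, b) ∈ F}.ncard : ℝ) * w l with ha
  have ha0 : ∀ l, 0 ≤ a l := fun l => mul_nonneg (Nat.cast_nonneg _) (hw0 l)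
  have hsum : Summable a := by
    rw [← summable_nat_add_iff L]
    refine Summable.of_nonneg_of_le (fun l => ha0 _) (fun l => ?_)
      ((summable_nat_add_iff L).2 (summable_geometric_two))
    have h1 : ({b | (l + L, b) ∈ F}.ncard : ℝ) ≤ n (l + L) := by
      exact_mod_cast hle (l + L) (by omega)
    show ({b | (l + L, b) ∈ F}.ncard : ℝ) * w (l + L) ≤ (1 / 2) ^ (l + L)
    rw [hw, mul_inv, one_div, inv_pow]
    have h2 : ({b | (l + L, b) ∈ F}.ncard : ℝ) * (1 + (n (l + L) : ℝ))⁻¹ ≤ 1 := by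
      rw [← div_eq_mul_inv, div_le_one (by positivity)]
      linarith
    have h3 : (0 : ℝ) ≤ ((2 : ℝ) ^ (l + L))⁻¹ := by positivity
    nlinarith [mul_le_mul_of_nonneg_left h2 h3]
  refine ⟨∑' l, a l, fun T hT => ?_⟩
  calc ∑ e ∈ T, w e.1 = ∑ l ∈ T.image Prod.fst, ∑ e ∈ T with e.1 = l, w e.1 :=
        (Finset.sum_fiberwise_of_maps_to (fun e he => Finset.mem_image_of_mem _ he) _).symm
    _ ≤ ∑ l ∈ T.image Prod.fst, a l := by
        refine Finset.sum_le_sum fun l _ => ?_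
        have h1 : ∑ e ∈ T with e.1 = l, w e.1 = ((T.filter (fun e => e.1 = l)).card : ℝ) * w l := by
          rw [Finset.sum_congr rfl (g := fun _ => w l) (fun e he => by
            rw [(Finset.mem_filter.1 he).2]), Finset.sum_const, nsmul_eq_mul]
        rw [h1]
        refine mul_le_mul_of_nonneg_right ?_ (hw0 l)
        have : ((T.filter (fun e => e.1 = l)).image Prod.snd).card =
            (T.filter (fun e => e.1 = l)).card := by
          refine Finset.card_image_of_injOn fun e he e' he' h => ?_
          have h1 := (Finset.mem_filter.1 he).2
          have h2 := (Finset.mem_filter.1 he').2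
          exact Prod.ext (h1.trans h2.symm) h
        have hle' : (((T.filter (fun e => e.1 = l)).image Prod.snd : Finset β) : Set β).ncard ≤
            {b | (l, b) ∈ F}.ncard := by
          refine Set.ncard_le_ncard (fun b hb => ?_) (hfin l)
          obtain ⟨e, he, rfl⟩ := Finset.mem_image.1 (Finset.mem_coe.1 hb)
          obtain ⟨heT, hel⟩ := Finset.mem_filter.1 he
          subst hel
          exact hT (Finset.mem_coe.2 heT)
        rw [Set.ncard_coe_finset, this] at hle'
        exact_mod_cast hle'
    _ ≤ ∑' l, a l := hsum.sum_le_tsum _ fun l _ => ha0 l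

end Transversal

section Transversal

variable {M : Type*} [MetricSpace M] [CompactSpace M]

/-- A finite chain of nested annuli (translates of the members of two classes)
separating `o` from `y`. -/
def IsAnnulusChain (J : Subgroup (M ≃ₜ M)) (o : M) (A A' : ℕ → ℕ → Set M) (y : M)
    (T : Finset (ℕ × ℕ × (M ≃ₜ M))) : Prop :=
  (∀ e ∈ T, e.2.2 ∈ J ∧ e.2.2 o ∉ A' e.1 e.2.1 ∧ e.2.2 y ∈ A e.1 e.2.1) ∧
    ∀ e ∈ T, ∀ e' ∈ T, e ≠ e' →
      (∀ x, e.2.2 x ∈ A' e.1 e.2.1 → e'.2.2 x ∈ A e'.1 e'.2.1) ∨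
      (∀ x, e'.2.2 x ∈ A' e'.1 e'.2.1 → e.2.2 x ∈ A e.1 e.2.1)

theorem IsAnnulusChain.splice {J : Subgroup (M ≃ₜ M)} {o : M} {A A' : ℕ → ℕ → Set M}
    (hgood : ∀ l, GoodClass J o (A l) (A' l)) {w : ℕ → ℝ} (hw1 : ∀ l, w l ≤ 1)
    {ε C : ℝ} (hε : 0 < ε)
    (hC : ∀ T : Finset (ℕ × ℕ × (M ≃ₜ M)), ↑T ⊆ {e : ℕ × ℕ × (M ≃ₜ M) | e.2.2 ∈ J ∧
      e.2.2 o ∉ A' e.1 e.2.1 ∧ ∃ q ∈ {q : M × M | ε ≤ dist q.1 q.2},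
      e.2.2 q.1 ∈ A e.1 e.2.1 ∧ e.2.2 q.2 ∈ A e.1 e.2.1} → ∑ e ∈ T, w e.1 ≤ C)
    {y : M} {h : M ≃ₜ M} (hh : h ∈ J) {T : Finset (ℕ × ℕ × (M ≃ₜ M))}
    (hT : IsAnnulusChain J o A A' (h y) T) (l : ℕ) {E : Finset (ℕ × (M ≃ₜ M))}
    (hE0 : E.Nonempty) (hE1 : ∀ e ∈ E, e.2 ∈ J ∧ e.2 o ∉ A' l e.1)
    (hE2 : ∀ e ∈ E, ∀ e' ∈ E, e ≠ e' → (∀ x, e.2 x ∈ A' l e.1 → e'.2 x ∈ A l e'.1) ∨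
      (∀ x, e'.2 x ∈ A' l e'.1 → e.2 x ∈ A l e.1))
    (hE3 : ∀ e ∈ E, ∀ x, dist (h x) (h y) < ε → e.2 x ∈ A l e.1)
    (hE4 : ∀ e ∈ E, ∃ x, e.2 x ∈ A l e.1 ∧ ε ≤ dist (h x) (h y)) :
    ∃ T', IsAnnulusChain J o A A' y T' ∧
      ∑ e ∈ T, w e.1 - C - 1 + E.card * w l ≤ ∑ e ∈ T', w e.1 := by
  classical
  have hsub := fun l => (hgood l).1
  set kept : Finset (ℕ × ℕ × (M ≃ₜ M)) :=
    T.filter fun e => ∀ x, e.2.2 x ∈ A' e.1 e.2.1 → dist x (h y) < ε with hkept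
  set lost : Finset (ℕ × ℕ × (M ≃ₜ M)) :=
    T.filter fun e => ¬∀ x, e.2.2 x ∈ A' e.1 e.2.1 → dist x (h y) < ε with hlost
  set F : Set (ℕ × ℕ × (M ≃ₜ M)) := {e : ℕ × ℕ × (M ≃ₜ M) | e.2.2 ∈ J ∧
      e.2.2 o ∉ A' e.1 e.2.1 ∧ ∃ q ∈ {q : M × M | ε ≤ dist q.1 q.2},
      e.2.2 q.1 ∈ A e.1 e.2.1 ∧ e.2.2 q.2 ∈ A e.1 e.2.1} with hF
  have hsplit : ∑ e ∈ kept, w e.1 + ∑ e ∈ lost, w e.1 = ∑ e ∈ T, w e.1 :=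
    Finset.sum_filter_add_sum_filter_not T _ _
  -- a lost element containing another lost element separates a pair of distant points
  have hlostF : ∀ e ∈ lost, ∀ e' ∈ lost,
      (∀ x, e.2.2 x ∈ A' e.1 e.2.1 → e'.2.2 x ∈ A e'.1 e'.2.1) → e' ∈ F := by
    intro e he e' he' hanc
    obtain ⟨heT, hne⟩ := Finset.mem_filter.1 he
    push Not at hne
    obtain ⟨x, hx, hd⟩ := hne
    have h' := hT.1 e' (Finset.mem_filter.1 he').1
    exact ⟨h'.1, h'.2.1, (x, h y), hd, hanc x hx, h'.2.2⟩
  have hlost_le : ∑ e ∈ lost, w e.1 ≤ C + 1 := by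
    rw [← Finset.sum_filter_add_sum_filter_not lost (fun e => e ∈ F)]
    refine add_le_add (hC _ fun e he => (Finset.mem_filter.1 (Finset.mem_coe.1 he)).2) ?_
    have hcard : (lost.filter fun e => e ∉ F).card ≤ 1 := by
      refine Finset.card_le_one.2 fun e he e' he' => ?_
      obtain ⟨h1, h2⟩ := Finset.mem_filter.1 he
      obtain ⟨h1', h2'⟩ := Finset.mem_filter.1 he'
      by_contra hne
      rcases hT.2 e (Finset.mem_filter.1 h1).1 e' (Finset.mem_filter.1 h1').1 hne with hh | hh
      · exact h2' (hlostF e h1 e' h1' hh)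
      · exact h2 (hlostF e' h1' e h1 hh)
    calc ∑ e ∈ lost with e ∉ F, w e.1 ≤ ∑ e ∈ lost with e ∉ F, (1 : ℝ) :=
          Finset.sum_le_sum fun e _ => hw1 _
      _ ≤ 1 := by
          rw [Finset.sum_const, nsmul_eq_mul, mul_one]
          exact_mod_cast hcard
  set tr : ℕ × ℕ × (M ≃ₜ M) → ℕ × ℕ × (M ≃ₜ M) := fun e => (e.1, e.2.1, e.2.2 * h) with htr
  have htr_inj : Function.Injective tr := by
    intro e e' hee
    have h1 := (Prod.ext_iff.1 hee)
    have h2 := (Prod.ext_iff.1 h1.2)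
    exact Prod.ext h1.1 (Prod.ext h2.1 (mul_right_cancel h2.2))
  set em : ℕ × (M ≃ₜ M) → ℕ × ℕ × (M ≃ₜ M) := fun e => (l, e) with hem
  have hem_inj : Function.Injective em := fun e e' hee => (Prod.ext_iff.1 hee).2
  have hdisj : Disjoint (kept.image tr) (E.image em) := by
    rw [Finset.disjoint_left]
    intro a ha ha'
    obtain ⟨e, he, rfl⟩ := Finset.mem_image.1 ha
    obtain ⟨e', he', hee⟩ := Finset.mem_image.1 ha'
    obtain ⟨x, hx, hd⟩ := hE4 e' he'
    have h1 : l = e.1 := (Prod.ext_iff.1 hee).1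
    have h2 : e' = (e.2.1, e.2.2 * h) := (Prod.ext_iff.1 hee).2
    subst h2
    subst h1
    exact absurd ((Finset.mem_filter.1 he).2 (h x) (hsub _ _ hx)) hd.not_gt
  have hcross : ∀ e ∈ kept, ∀ e' ∈ E, ∀ x, e.2.2 (h x) ∈ A' e.1 e.2.1 → e'.2 x ∈ A l e'.1 :=
    fun e he e' he' x hx => hE3 e' he' x ((Finset.mem_filter.1 he).2 _ hx)
  refine ⟨kept.image tr ∪ E.image em, ⟨?_, ?_⟩, ?_⟩
  · intro a ha
    rcases Finset.mem_union.1 ha with ha | ha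
    · obtain ⟨e, he, rfl⟩ := Finset.mem_image.1 ha
      obtain ⟨heT, hek⟩ := Finset.mem_filter.1 he
      obtain ⟨h1, h2, h4⟩ := hT.1 e heT
      refine ⟨J.mul_mem h1 hh, fun ho => ?_, h4⟩
      obtain ⟨e', he'⟩ := hE0
      exact (hE1 e' he').2 (hsub _ _ (hcross e he e' he' o ho))
    · obtain ⟨e, he, rfl⟩ := Finset.mem_image.1 ha
      exact ⟨(hE1 e he).1, (hE1 e he).2, hE3 e he y (by rwa [dist_self])⟩
  · intro a ha a' ha' hne
    rcases Finset.mem_union.1 ha with ha | ha <;> rcases Finset.mem_union.1 ha' with ha' | ha' <;>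
      obtain ⟨e, he, rfl⟩ := Finset.mem_image.1 ha <;>
      obtain ⟨e', he', rfl⟩ := Finset.mem_image.1 ha'
    · exact (hT.2 e (Finset.mem_filter.1 he).1 e' (Finset.mem_filter.1 he').1
        (fun h => hne (congrArg tr h))).imp (fun H x hx => H (h x) hx) (fun H x hx => H (h x) hx)
    · exact Or.inl fun x hx => hcross e he e' he' x hx
    · exact Or.inr fun x hx => hcross e' he' e he x hx
    · exact hE2 e he e' he' (fun h => hne (congrArg em h))
  · rw [Finset.sum_union hdisj, Finset.sum_image htr_inj.injOn, Finset.sum_image hem_inj.injOn]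
    have h1 : ∑ e ∈ E, w (em e).1 = E.card * w l := by
      simp [hem, nsmul_eq_mul]
    have h2 : ∑ e ∈ kept, w (tr e).1 = ∑ e ∈ kept, w e.1 := rfl
    rw [h1, h2]
    linarith

theorem not_wins_of_goodClasses {J : Subgroup (M ≃ₜ M)}
    {o : M} {A A' : ℕ → ℕ → Set M}
    (hgood : ∀ l, GoodClass J o (A l) (A' l)) {x : ℕ → M} (hx : ∀ k, x k ∉ limitSet J)
    (hacc : ∀ y : ℕ → M, (∀ k, ∃ j ∈ J, y k = j (x k)) → ∃ φ : ℕ → ℕ, StrictMono φ ∧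
      ∃ l, Wins J o (A l) (A' l) (y ∘ φ)) : False := by
  classical
  set Q : ℕ → Set (M × M) := fun l => {q | (1 : ℝ) / (l + 1) ≤ dist q.1 q.2} ∪
    (fun y => (y, y)) '' (x '' Set.Iic l) with hQ
  have hQc : ∀ l, Collapses J (Q l) := fun l =>
    (collapses_dist J (by positivity)).union (collapses_diag ((Set.finite_Iic l).image x)
      (by rintro _ ⟨k, -, rfl⟩; exact hx k))
  set S : ℕ → Set (M × M) → Set (ℕ × (M ≃ₜ M)) := fun l R =>
    {e : ℕ × (M ≃ₜ M) | e.2 ∈ J ∧ e.2 o ∉ A' l e.1 ∧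
      ∃ q ∈ R, e.2 q.1 ∈ A l e.1 ∧ e.2 q.2 ∈ A l e.1} with hS
  have hSmono : ∀ l R R', R ⊆ R' → S l R ⊆ S l R' := by
    rintro l R R' h e ⟨h1, h2, q, hq, h4⟩
    exact ⟨h1, h2, q, h hq, h4⟩
  set n : ℕ → ℕ := fun l => (S l (Q l)).ncard with hn
  set w : ℕ → ℝ := fun l => ((2 : ℝ) ^ l * (1 + n l))⁻¹ with hw
  have hw0 : ∀ l, 0 < w l := fun l => by positivity
  have hw1 : ∀ l, w l ≤ 1 := fun l => inv_le_one_of_one_le₀ (by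
    have h1 : (1 : ℝ) ≤ 2 ^ l := one_le_pow₀ (by norm_num)
    have h2 : (0 : ℝ) ≤ n l := Nat.cast_nonneg _
    nlinarith)
  have hbound : ∀ (R : Set (M × M)) (L : ℕ), Collapses J R → (∀ l ≥ L, R ⊆ Q l) →
      ∃ C : ℝ, ∀ T : Finset (ℕ × ℕ × (M ≃ₜ M)), ↑T ⊆ {e : ℕ × ℕ × (M ≃ₜ M) | e.2.2 ∈ J ∧
      e.2.2 o ∉ A' e.1 e.2.1 ∧ ∃ q ∈ R,
      e.2.2 q.1 ∈ A e.1 e.2.1 ∧ e.2.2 q.2 ∈ A e.1 e.2.1} → ∑ e ∈ T, w e.1 ≤ C := by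
    intro R L hR hRL
    refine exists_sum_weight_le (n := n) (L := L) (fun l => (hgood l).2 R hR) (fun l hl => ?_)
      (fun l => rfl)
    exact Set.ncard_le_ncard (hSmono l _ _ (hRL l hl)) ((hgood l).2 _ (hQc l))
  have hbest : ∀ k, ∃ j ∈ J, ∃ B : ℝ, (∀ T, IsAnnulusChain J o A A' (j (x k)) T →
      ∑ e ∈ T, w e.1 ≤ B) ∧ ∀ h ∈ J, ∃ T, IsAnnulusChain J o A A' (h (j (x k))) T ∧
        B - 1 < ∑ e ∈ T, w e.1 := by
    intro k
    set 𝔅 : Set ℝ := {B | ∃ j ∈ J, ∀ T, IsAnnulusChain J o A A' (j (x k)) T →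
      ∑ e ∈ T, w e.1 ≤ B} with h𝔅
    have hbdd : BddBelow 𝔅 := by
      refine ⟨0, ?_⟩
      rintro B ⟨j, -, hB⟩
      simpa using hB ∅ ⟨by simp, by simp⟩
    have hne : 𝔅.Nonempty := by
      obtain ⟨C, hC⟩ := hbound ((fun y => (y, y)) '' {x k}) k
        (collapses_diag (Set.finite_singleton _) (by rintro _ rfl; exact hx k))
        (by
          rintro l hl _ ⟨_, rfl, rfl⟩
          exact Or.inr ⟨x k, ⟨k, hl, rfl⟩, rfl⟩)
      refine ⟨C, 1, J.one_mem, fun T hT => hC T fun e he => ?_⟩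
      obtain ⟨h1, h2, h4⟩ := hT.1 e he
      exact ⟨h1, h2, _, ⟨x k, rfl, rfl⟩, h4, h4⟩
    obtain ⟨B, ⟨j, hj, hB⟩, hlt⟩ := exists_lt_of_csInf_lt hne (lt_add_one (sInf 𝔅))
    refine ⟨j, hj, B, hB, fun h hh => ?_⟩
    by_contra! hcon
    have : B - 1 ∈ 𝔅 := ⟨h * j, J.mul_mem hh hj, hcon⟩
    linarith [csInf_le hbdd this]
  choose j hj B hB hB' using hbest
  obtain ⟨φ, hφ, l, ε, hε, hwin⟩ := hacc (fun k => j k (x k)) fun k => ⟨j k, hj k, rfl⟩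
  obtain ⟨L, hL⟩ := exists_nat_one_div_lt hε
  obtain ⟨C, hC⟩ := hbound {q | ε ≤ dist q.1 q.2} L (collapses_dist J hε) (fun l' hl' q hq =>
    Or.inl ((Nat.one_div_le_one_div hl').trans (hL.le.trans hq)))
  obtain ⟨N, hN⟩ := exists_nat_gt ((C + 2) / w l)
  obtain ⟨k, h, hh, E, hEN, hE1, hE2, hE3, hE4⟩ := hwin (N + 1)
  obtain ⟨T, hT, hTB⟩ := hB' (φ k) h hh
  obtain ⟨T', hT', hsum⟩ := hT.splice hgood hw1 hε hC hh l
    (Finset.card_pos.1 (by omega)) hE1 hE2 hE3 hE4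
  have h1 := hB (φ k) T' hT'
  have h2 : C + 2 < N * w l := (div_lt_iff₀ (hw0 l)).1 hN
  have h4 : (N : ℝ) * w l ≤ E.card * w l :=
    mul_le_mul_of_nonneg_right (by exact_mod_cast (Nat.le_succ N).trans hEN) (hw0 l).le
  linarith

/-- A discrete convergence group all of whose limit points are conical or have a cocompact
stabilizer acts cocompactly on the part of an invariant set that lies off the limit set. -/
theorem exists_closed_transversal {J : Subgroup (M ≃ₜ M)} (hJ : IsDiscreteConvGroup J)
    (h3 : ThreePoints M) {X : Set M} (hX : ∀ j ∈ J, ∀ x ∈ X, j x ∈ X) {S : Set M}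
    (hS : S.Countable)
    (hyp : ∀ ξ ∈ limitSet J, IsConicalLimitPt J ξ ∨ (ξ ∈ S ∧ ¬IsConicalLimitPt J ξ ∧
      ∃ K, IsClosed K ∧ ξ ∉ K ∧ ∀ x ∈ X, x ≠ ξ → ∃ p ∈ J, p ξ = ξ ∧ p x ∈ K)) :
    ∃ C, IsClosed C ∧ (∀ x ∈ C, x ∉ limitSet J) ∧
      ∀ x ∈ X, x ∉ limitSet J → ∃ j ∈ J, j x ∈ C := by
  classical
  have hcl := isClosed_limitSet hJ h3
  rcases (limitSet J).eq_empty_or_nonempty with hemp | hne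
  · exact ⟨univ, isClosed_univ, fun x _ => by simp [hemp], fun x _ _ => ⟨1, J.one_mem, trivial⟩⟩
  by_contra hcon
  have hbad : ∀ n : ℕ, ∃ x ∈ X, x ∉ limitSet J ∧
      ∀ j ∈ J, Metric.infDist (j x) (limitSet J) < 1 / ((n : ℝ) + 1) := by
    intro n
    by_contra! hn
    refine hcon ⟨{x | 1 / ((n : ℝ) + 1) ≤ Metric.infDist x (limitSet J)},
      isClosed_le continuous_const (Metric.continuous_infDist_pt _), fun x hx hxL => ?_, hn⟩
    have h1 : 1 / ((n : ℝ) + 1) ≤ Metric.infDist x (limitSet J) := hx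
    rw [Metric.infDist_zero_of_mem hxL] at h1
    have : (0 : ℝ) < 1 / ((n : ℝ) + 1) := by positivity
    linarith
  choose x hxX hxL hxd using hbad
  set o := x 0 with ho
  have hoc : ¬IsConicalLimitPt J o := fun h => hxL 0 (h.mem_limitSet hJ h3)
  -- the countable family of classes
  set basic : ℕ × ℕ → (ℕ → Set M) × (ℕ → Set M) := by
    have : Nonempty M := ⟨o⟩
    exact fun i => (fun r => if r = 0 then Metric.closedBall (TopologicalSpace.denseSeq M i.1)
      (1 / ((i.2 : ℝ) + 1)) else ∅, fun r => if r = 0 then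
      Metric.ball (TopologicalSpace.denseSeq M i.1) (2 * (1 / ((i.2 : ℝ) + 1))) else ∅)
    with hbasic
  have hhoro : ∀ ξ : {ξ | ξ ∈ S ∧ ξ ∈ limitSet J ∧ ¬IsConicalLimitPt J ξ ∧
      ∃ K, IsClosed K ∧ ξ ∉ K ∧ ∀ x ∈ X, x ≠ ξ → ∃ p ∈ J, p ξ = ξ ∧ p x ∈ K},
      ∃ c : (ℕ → Set M) × (ℕ → Set M), GoodClass J o c.1 c.2 ∧
        ∀ y : ℕ → M, (∀ k, y k ∈ X ∧ y k ∉ limitSet J) → Tendsto y atTop (𝓝 ξ.1) →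
          Wins J o c.1 c.2 y := by
    rintro ⟨ξ, -, hξL, hξc, K, hK, hξK, hcov⟩
    obtain ⟨ρ, h1, h2, h4, h5⟩ := exists_horoball_radii hJ hξc
    refine ⟨(_, _), goodClass_horoball hJ hξL hoc hK hξK (fun g hg => ?_) h2 h5,
      fun y hy hyt => ?_⟩
    · exact hcov (g o) (hX g hg o (hxX 0))
        fun h => hxL 0 ((apply_mem_limitSet_iff hg).1 (by rw [← ho, h]; exact hξL))
    · exact wins_of_cocompact hJ h3 hξc (fun h => hxL 0 (by rw [← ho, h]; exact hξL)) hK hξK h1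
        h2 h4 hyt fun k => hcov _ (hy k).1 fun h => (hy k).2 (h ▸ hξL)
  choose horo hhoro1 hhoro2 using hhoro
  have hcount : (Set.range basic ∪ Set.range horo).Countable := by
    refine (Set.countable_range _).union ?_
    have : Countable {ξ | ξ ∈ S ∧ ξ ∈ limitSet J ∧ ¬IsConicalLimitPt J ξ ∧
      ∃ K, IsClosed K ∧ ξ ∉ K ∧ ∀ x ∈ X, x ≠ ξ → ∃ p ∈ J, p ξ = ξ ∧ p x ∈ K} :=
      (hS.mono fun ξ h => h.1).to_subtype
    exact Set.countable_range _
  obtain ⟨c, hc⟩ := hcount.exists_eq_range ⟨_, Or.inl ⟨(0, 0), rfl⟩⟩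
  refine not_wins_of_goodClasses (A := fun l => (c l).1) (A' := fun l => (c l).2) (o := o)
    (fun l => ?_) hxL (fun y hy => ?_)
  · have : c l ∈ Set.range basic ∪ Set.range horo := hc ▸ Set.mem_range_self l
    rcases this with ⟨i, hi⟩ | ⟨ξ, hξ⟩
    · rw [← hi]
      exact goodClass_ball hJ hoc _ (by positivity)
    · rw [← hξ]
      exact hhoro1 ξ
  · have hyX : ∀ k, y k ∈ X ∧ y k ∉ limitSet J := by
      intro k
      obtain ⟨j, hj, he⟩ := hy k
      rw [he]
      exact ⟨hX j hj _ (hxX k), fun h => hxL k ((apply_mem_limitSet_iff hj).1 h)⟩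
    have hyd : ∀ k : ℕ, Metric.infDist (y k) (limitSet J) < 1 / ((k : ℝ) + 1) := by
      intro k
      obtain ⟨j, hj, he⟩ := hy k
      rw [he]
      exact hxd k j hj
    obtain ⟨ξ, -, φ, hφ, hφt⟩ := isCompact_univ.tendsto_subseq (fun k => mem_univ (y k))
    have hξL : ξ ∈ limitSet J := by
      rw [hcl.mem_iff_infDist_zero hne]
      have h1 := ((Metric.continuous_infDist_pt (limitSet J)).tendsto ξ).comp hφt
      have h2 : Tendsto (fun k => Metric.infDist (y (φ k)) (limitSet J)) atTop (𝓝 0) :=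
        squeeze_zero (fun _ => Metric.infDist_nonneg) (fun k => (hyd (φ k)).le)
          (tendsto_one_div_add_atTop_nhds_zero_nat.comp hφ.tendsto_atTop)
      exact tendsto_nhds_unique h1 h2
    have hfind : ∀ d, d ∈ Set.range basic ∪ Set.range horo →
        Wins J o d.1 d.2 (y ∘ φ) → ∃ l, Wins J o (c l).1 (c l).2 (y ∘ φ) := by
      intro d hd hwin
      rw [hc] at hd
      obtain ⟨l, rfl⟩ := hd
      exact ⟨l, hwin⟩
    refine ⟨φ, hφ, ?_⟩
    rcases hyp ξ hξL with hcon | ⟨hξS, hξc, hK⟩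
    · obtain ⟨g, a, b, hg, ha, hab⟩ := hcon.exists_convIn hJ h3
      obtain ⟨m, hm⟩ := exists_nat_one_div_lt (div_pos (dist_pos.2 hab) three_pos)
      have : Nonempty M := ⟨o⟩
      have hpos : (0 : ℝ) < 1 / ((m : ℝ) + 1) := by positivity
      obtain ⟨i, hi⟩ := (TopologicalSpace.denseRange_denseSeq M).exists_dist_lt a hpos
      exact hfind _ (Or.inl ⟨(i, m), rfl⟩) (wins_of_conical hoc hg ha hpos hi
        (by linarith) hφt fun k h => (hyX (φ k)).2 (by rw [show y (φ k) = ξ from h]; exact hξL))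
    · exact hfind _ (Or.inr ⟨⟨ξ, hξS, hξL, hξc, hK⟩, rfl⟩)
        (hhoro2 _ _ (fun k => hyX (φ k)) hφt)

end Transversal

section PingPong

variable {M : Type*} [MetricSpace M] [CompactSpace M]

/-- A sign-symmetric form of the HNN ping-pong position: the sign `true` stands for `1` and
`false` for `-1`, and `F true = f`, `F false = f⁻¹`. -/
structure SignedPingPong (G₀ G : Subgroup (M ≃ₜ M)) (J : Bool → Subgroup (M ≃ₜ M))
    (F : Bool → M ≃ₜ M) (B : Bool → Set M) : Prop where
  discrete : IsDiscreteConvGroup G₀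
  le : ∀ s, J s ≤ G₀
  F_not : ∀ s, F (!s) = (F s)⁻¹
  isClosed : ∀ s, IsClosed (B s)
  int_nonempty : ∀ s, (interior (B s)).Nonempty
  inv : ∀ s, ∀ j ∈ J s, ∀ x ∈ B s, j x ∈ B s
  prec : ∀ s, ∀ g ∈ G₀, ∀ x ∈ B s, g x ∈ B s → g ∈ J s
  cross : ∀ s, ∀ g ∈ G₀, ∀ x ∈ B s, g x ∉ B (!s)
  mapsTo : ∀ s x, x ∉ B (!s) → F s x ∈ B s
  conj : ∀ s, ∀ j ∈ J (!s), F s * j * (F s)⁻¹ ∈ J s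
  lim : ∀ s, ∀ x ∈ limitSet G₀, x ∈ B s → x ∈ limitSet (J s)
  lim_subset : ∀ s, limitSet (J s) ⊆ B s
  proper : ∃ a, ∀ g ∈ G₀, ∀ s, g a ∉ B s
  gen : G = G₀ ⊔ Subgroup.zpowers (F true)

theorem HNNPingPong.signed {G₀ J₁ Jm G : Subgroup (M ≃ₜ M)} {f : M ≃ₜ M} {B₁ Bm : Set M}
    (h : HNNPingPong G₀ J₁ Jm f B₁ Bm) (hd : IsDiscreteConvGroup G₀) (h₁ : J₁ ≤ G₀)
    (hm : Jm ≤ G₀) (hconj : ∀ x, x ∈ J₁ ↔ f⁻¹ * x * f ∈ Jm)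
    (hG : G = G₀ ⊔ Subgroup.zpowers f) :
    SignedPingPong G₀ G (fun s => bif s then J₁ else Jm) (fun s => bif s then f else f⁻¹)
      (fun s => bif s then B₁ else Bm) := by
  have hcross : ∀ g ∈ G₀, ∀ x ∈ B₁, g x ∉ Bm := fun g hg x hx hgx => by
    have : g x ∈ ⇑g '' B₁ ∩ Bm := ⟨mem_image_of_mem _ hx, hgx⟩
    rw [h.cross g hg] at this
    exact this
  have hmap : ∀ x, x ∉ Bm → f x ∈ B₁ := fun x hx => by
    refine interior_subset (h.mapf ▸ mem_image_of_mem _ ?_)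
    by_cases hx1 : x ∈ B₁
    · exact Or.inr hx1
    · exact Or.inl fun h => h.elim hx1 hx
  have hmem : ∀ x, x ∈ B₁ → x ∈ interior B₁ ∨ f⁻¹ x ∈ Bm := fun x hx => by
    by_contra! hcon
    refine hcon.1 (h.mapf ▸ ⟨f⁻¹ x, ?_, apply_inv_self f x⟩)
    by_cases hx1 : f⁻¹ x ∈ B₁
    · exact Or.inr hx1
    · exact Or.inl fun h => h.elim hx1 hcon.2
  have hmap' : ∀ x, x ∉ B₁ → f⁻¹ x ∈ Bm := fun x hx => by
    by_contra hc
    exact hx (by simpa [apply_inv_self] using hmap _ hc)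
  refine ⟨hd, ?_, ?_, ?_, ?_, ?_, ?_, ?_, ?_, ?_, ?_, ?_, ?_, by simpa using hG⟩
  · rintro (_ | _)
    exacts [hm, h₁]
  · rintro (_ | _) <;> simp
  · rintro (_ | _)
    exacts [h.isClosedm, h.isClosed₁]
  · rintro (_ | _)
    exacts [h.int_nonemptym, h.int_nonempty₁]
  · rintro (_ | _) j hj x hx
    · exact (h.invm j hj).subset (mem_image_of_mem _ hx)
    · exact (h.inv₁ j hj).subset (mem_image_of_mem _ hx)
  · rintro (_ | _) g hg x hx hgx
    · by_contra hj
      exact (h.precm g hg hj).subset ⟨mem_image_of_mem _ hx, hgx⟩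
    · by_contra hj
      exact (h.prec₁ g hg hj).subset ⟨mem_image_of_mem _ hx, hgx⟩
  · rintro (_ | _) g hg x hx hgx
    · exact hcross g⁻¹ (inv_mem hg) _ hgx (by simpa [inv_apply_self] using hx)
    · exact hcross g hg x hx hgx
  · rintro (_ | _) x hx
    · exact hmap' x hx
    · exact hmap x hx
  · rintro (_ | _) j hj
    · simpa using (hconj j).1 hj
    · change f * j * f⁻¹ ∈ J₁
      rw [hconj, show f⁻¹ * (f * j * f⁻¹) * f = j by group]
      exact hj
  · rintro (_ | _) x hx hxB
    · exact h.limm.subset ⟨hx, hxB⟩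
    · exact h.lim₁.subset ⟨hx, hxB⟩
  · rintro (_ | _) x hx
    · exact (h.limm.symm.subset hx).2
    · exact (h.lim₁.symm.subset hx).2
  · obtain ⟨a, ha⟩ := h.proper
    refine ⟨a, fun g hg s hga => ha ?_⟩
    refine mem_iUnion₂.2 ⟨g⁻¹, inv_mem hg, g a, ?_, inv_apply_self g a⟩
    cases s
    exacts [Or.inr hga, Or.inl hga]

/-- `Red G₀ J F s h t k u`: the element `u` has a reduced expression starting with `h * F s`
and ending with `F t * k`. -/
inductive Red (G₀ : Subgroup (M ≃ₜ M)) (J : Bool → Subgroup (M ≃ₜ M)) (F : Bool → M ≃ₜ M) :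
    Bool → (M ≃ₜ M) → Bool → (M ≃ₜ M) → (M ≃ₜ M) → Prop
  | base {s h k} : h ∈ G₀ → k ∈ G₀ → Red G₀ J F s h s k (h * F s * k)
  | step {s h s' h' t k v} : h ∈ G₀ → ¬(s' = !s ∧ h' ∈ J (!s)) → Red G₀ J F s' h' t k v →
      Red G₀ J F s h t k (h * F s * v)

/-- `Tail G₀ J F s v`: the element `v` may follow the letter `F s` in a reduced expression. -/
def Tail (G₀ : Subgroup (M ≃ₜ M)) (J : Bool → Subgroup (M ≃ₜ M)) (F : Bool → M ≃ₜ M)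
    (s : Bool) (v : M ≃ₜ M) : Prop :=
  v ∈ G₀ ∨ ∃ s' h t k, Red G₀ J F s' h t k v ∧ ¬(s' = !s ∧ h ∈ J (!s))

section Words

variable {G₀ : Subgroup (M ≃ₜ M)} {J : Bool → Subgroup (M ≃ₜ M)} {F : Bool → M ≃ₜ M}
  {s t : Bool} {h k u v : M ≃ₜ M}

theorem Red.left_mem (hu : Red G₀ J F s h t k u) : h ∈ G₀ := by
  cases hu <;> assumption

theorem Red.right_mem (hu : Red G₀ J F s h t k u) : k ∈ G₀ := by
  induction hu <;> assumption

theorem Red.mul_left (hu : Red G₀ J F s h t k u) {g : M ≃ₜ M} (hg : g ∈ G₀) :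
    Red G₀ J F s (g * h) t k (g * u) := by
  cases hu with
  | base h1 h2 => simpa only [mul_assoc] using Red.base (mul_mem hg h1) h2
  | step h1 h2 h3 => simpa only [mul_assoc] using Red.step (mul_mem hg h1) h2 h3

theorem Red.mul_right (hu : Red G₀ J F s h t k u) {g : M ≃ₜ M} (hg : g ∈ G₀) :
    Red G₀ J F s h t (k * g) (u * g) := by
  induction hu with
  | base h1 h2 => simpa only [mul_assoc] using Red.base h1 (mul_mem h2 hg)
  | step h1 h2 _ ih => simpa only [mul_assoc] using Red.step h1 h2 ih

theorem Red.exists_tail (hu : Red G₀ J F s h t k u) :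
    ∃ v, Tail G₀ J F s v ∧ u = h * F s * v := by
  cases hu with
  | base h1 h2 => exact ⟨_, Or.inl h2, rfl⟩
  | step h1 h2 h3 => exact ⟨_, Or.inr ⟨_, _, _, _, h3, h2⟩, rfl⟩

theorem Tail.mul_left (hJ : ∀ s, J s ≤ G₀) (hv : Tail G₀ J F s v) {j : M ≃ₜ M}
    (hj : j ∈ J (!s)) : Tail G₀ J F s (j * v) := by
  rcases hv with hv | ⟨s', h, t, k, hv, hn⟩
  · exact Or.inl (mul_mem (hJ _ hj) hv)
  · exact Or.inr ⟨s', j * h, t, k, hv.mul_left (hJ _ hj), fun H =>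
      hn ⟨H.1, (Subgroup.mul_mem_cancel_left _ hj).1 H.2⟩⟩

end Words

namespace SignedPingPong

variable {G₀ G : Subgroup (M ≃ₜ M)} {J : Bool → Subgroup (M ≃ₜ M)}
    {F : Bool → M ≃ₜ M} {B : Bool → Set M} (H : SignedPingPong G₀ G J F B)
include H

variable {s t : Bool} {h k u v : M ≃ₜ M}

theorem le_group : G₀ ≤ G := H.gen ▸ le_sup_left

theorem F_mem (s : Bool) : F s ∈ G := by
  have h1 : F true ∈ G := H.gen ▸ Subgroup.mem_sup_right (Subgroup.mem_zpowers _)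
  cases s
  · rw [show false = !true from rfl, H.F_not]
    exact inv_mem h1
  · exact h1

theorem F_not_apply (s : Bool) (x : M) : F (!s) (F s x) = x := by
  rw [H.F_not, inv_apply_self]

theorem F_apply_not (s : Bool) (x : M) : F s (F (!s) x) = x := by
  rw [H.F_not, apply_inv_self]

theorem conj' (s : Bool) {j : M ≃ₜ M} (hj : j ∈ J (!s)) : F s * j * F (!s) ∈ J s := by
  rw [H.F_not]
  exact H.conj s j hj

theorem inv_iff (s : Bool) {j : M ≃ₜ M} (hj : j ∈ J s) {x : M} : j x ∈ B s ↔ x ∈ B s :=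
  ⟨fun hx => by simpa [inv_apply_self] using H.inv s j⁻¹ (inv_mem hj) _ hx, H.inv s j hj x⟩

/-- If two translates `h B s` and `B t` meet then `s = t` and `h ∈ J s`. -/
theorem eq_of_mem {x : M} (hh : h ∈ G₀) (hx : h⁻¹ x ∈ B s) (hxt : x ∈ B t) :
    s = t ∧ h ∈ J s := by
  have hst : s = t := by
    by_contra hne
    have ht : t = !s := by cases s <;> cases t <;> simp_all
    subst ht
    exact H.cross s h hh _ hx (by rwa [apply_inv_self])
  subst hst
  exact ⟨rfl, H.prec s h hh _ hx (by rwa [apply_inv_self])⟩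

theorem not_mem_of_ne {x : M} {s' : Bool} (hh : h ∈ G₀) (hx : h⁻¹ x ∈ B s')
    (hn : ¬(s' = !s ∧ h ∈ J (!s))) : x ∉ B (!s) := fun hxs => by
  obtain ⟨rfl, h2⟩ := H.eq_of_mem hh hx hxs
  exact hn ⟨rfl, h2⟩

theorem F_limitSet (s : Bool) {x : M} (hx : x ∈ limitSet (J (!s))) : F s x ∈ limitSet (J s) :=
  apply_mem_limitSet_of_conj (H.conj s) hx

theorem limitSet_le (s : Bool) {x : M} (hx : x ∈ limitSet (J s)) : x ∈ limitSet G₀ :=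
  limitSet_mono (H.le s) hx

theorem threePoints : ThreePoints M := by
  obtain ⟨a, ha⟩ := H.proper
  obtain ⟨b, hb⟩ := H.int_nonempty true
  obtain ⟨c, hc⟩ := H.int_nonempty false
  replace hb := interior_subset hb
  replace hc := interior_subset hc
  have hab : a ≠ b := fun h => ha 1 (one_mem _) true (h ▸ hb)
  have hac : a ≠ c := fun h => ha 1 (one_mem _) false (h ▸ hc)
  have hbc : b ≠ c := fun h => H.cross true 1 (one_mem _) b hb (h ▸ hc)
  intro x y
  by_contra! hcon
  have h1 := hcon a
  have h2 := hcon b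
  have h3 := hcon c
  by_cases hax : a = x
  · exact hbc ((h2 fun h => hab (hax.trans h.symm)).trans (h3 fun h => hac (hax.trans h.symm)).symm)
  · by_cases hbx : b = x
    · exact hac ((h1 hax).trans (h3 fun h => hbc (hbx.trans h.symm)).symm)
    · exact hab ((h1 hax).trans (h2 hbx).symm)

theorem red_apply (hu : Red G₀ J F s h t k u) {z : M} (hz : k z ∉ B (!t)) :
    h⁻¹ (u z) ∈ B s := by
  induction hu with
  | base h1 h2 =>
    simp only [mul_apply, inv_apply_self]
    exact H.mapsTo _ _ hz
  | step h1 h2 h3 ih =>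
    simp only [mul_apply, inv_apply_self]
    exact H.mapsTo _ _ (H.not_mem_of_ne h3.left_mem (ih hz) h2)

theorem red_apply_limitSet (hu : Red G₀ J F s h t k u) {z : M} (hz : z ∈ limitSet G₀) :
    h⁻¹ (u z) ∈ B s := by
  induction hu with
  | @base s h k h1 h2 =>
    simp only [mul_apply, inv_apply_self]
    by_cases hk : k z ∈ B (!s)
    · exact H.lim_subset s (H.F_limitSet s (H.lim _ _ (apply_mem_limitSet h2 hz) hk))
    · exact H.mapsTo _ _ hk
  | step h1 h2 h3 ih =>
    simp only [mul_apply, inv_apply_self]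
    exact H.mapsTo _ _ (H.not_mem_of_ne h3.left_mem ih h2)

theorem tail_apply_base (hv : Tail G₀ J F s v) {a : M} (ha : ∀ g ∈ G₀, ∀ s, g a ∉ B s) :
    v a ∉ B (!s) := by
  rcases hv with hv | ⟨s', h', t, k, hv, hn⟩
  · exact ha v hv _
  · exact H.not_mem_of_ne hv.left_mem (H.red_apply hv (ha k hv.right_mem _)) hn

theorem mem_or_red (hu : u ∈ G) : u ∈ G₀ ∨ ∃ s h t k, Red G₀ J F s h t k u := by
  set P : (M ≃ₜ M) → Prop := fun u => u ∈ G₀ ∨ ∃ s h t k, Red G₀ J F s h t k u with hP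
  have hG₀ : ∀ g ∈ G₀, ∀ u, P u → P (g * u) := by
    rintro g hg u (hu | ⟨s, h, t, k, hu⟩)
    · exact Or.inl (mul_mem hg hu)
    · exact Or.inr ⟨_, _, _, _, hu.mul_left hg⟩
  have hF : ∀ s u, P u → P (F s * u) := by
    rintro s u (hu | ⟨s', h, t, k, hu⟩)
    · exact Or.inr ⟨s, 1, s, u, by simpa using Red.base (one_mem _) hu⟩
    · by_cases hn : s' = !s ∧ h ∈ J (!s)
      · obtain ⟨rfl, hh⟩ := hn
        obtain ⟨v, hv, rfl⟩ := hu.exists_tail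
        have : F s * (h * F (!s) * v) = (F s * h * F (!s)) * v := by simp only [mul_assoc]
        rw [this]
        refine hG₀ _ (H.le s (H.conj' s hh)) v ?_
        rcases hv with hv | ⟨s', h', t', k', hv, -⟩
        exacts [Or.inl hv, Or.inr ⟨_, _, _, _, hv⟩]
      · exact Or.inr ⟨s, 1, t, k, by simpa using Red.step (one_mem _) hn hu⟩
  let S : Subgroup (M ≃ₜ M) :=
    { carrier := {g | (∀ u, P u → P (g * u)) ∧ ∀ u, P u → P (g⁻¹ * u)}
      one_mem' := by simp
      mul_mem' := by
        rintro a b ⟨ha, ha'⟩ ⟨hb, hb'⟩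
        refine ⟨fun u hu => ?_, fun u hu => ?_⟩
        · rw [mul_assoc]
          exact ha _ (hb _ hu)
        · rw [mul_inv_rev, mul_assoc]
          exact hb' _ (ha' _ hu)
      inv_mem' := by
        rintro a ⟨ha, ha'⟩
        exact ⟨ha', by simpa using ha⟩ }
  have hS : G ≤ S := by
    rw [H.gen]
    refine sup_le (fun g hg => ⟨hG₀ g hg, hG₀ _ (inv_mem hg)⟩) ?_
    rw [Subgroup.zpowers_le]
    refine ⟨hF true, ?_⟩
    rw [← H.F_not]
    exact hF _
  have := (hS hu).1 1 (Or.inl (one_mem _))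
  rwa [mul_one] at this

/-- The stabilizer in `G` of a limit point of `G₀` is contained in `G₀`. -/
theorem mem_of_fixed (hu : u ∈ G) {x : M} (hx : x ∈ limitSet G₀) (hux : u x = x) : u ∈ G₀ := by
  rcases H.mem_or_red hu with hu | ⟨s, h, t, k, hu⟩
  · exact hu
  exfalso
  obtain ⟨v, hv, rfl⟩ := hu.exists_tail
  have h1 := H.red_apply_limitSet hu hx
  rw [hux] at h1
  have hxh := apply_mem_limitSet (inv_mem hu.left_mem) hx
  have h2 : F (!s) (h⁻¹ x) ∈ B (!s) := by
    refine H.lim_subset _ (H.F_limitSet _ ?_)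
    rw [Bool.not_not]
    exact H.lim s _ hxh h1
  have h3 : F (!s) (h⁻¹ x) = v x := by
    have : h⁻¹ x = F s (v x) := by
      conv_lhs => rw [← hux]
      simp only [mul_apply, inv_apply_self]
    rw [this, H.F_not_apply]
  rw [h3] at h2
  rcases hv with hv | ⟨s', h', t', k', hv, hn⟩
  · refine H.cross s (v * h) (mul_mem hv hu.left_mem) _ h1 ?_
    rwa [mul_apply, apply_inv_self]
  · exact H.not_mem_of_ne hv.left_mem (H.red_apply_limitSet hv hx) hn h2

theorem mem_J_of_fixed (hu : u ∈ G) {x : M} (hx : x ∈ limitSet (J s)) (hux : u x = x) :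
    u ∈ J s := by
  have hB := H.lim_subset s hx
  exact H.prec s u (H.mem_of_fixed hu (H.limitSet_le s hx) hux) x hB (by rwa [hux])

/-- A point of `B s` outside of the limit set of `G₀`. -/
theorem exists_mem_not_limitSet (s : Bool) : ∃ o ∈ B s, o ∉ limitSet G₀ := by
  obtain ⟨o, ho⟩ := H.int_nonempty s
  refine ⟨o, interior_subset ho, fun hoL => ?_⟩
  obtain ⟨g, z, hg⟩ := mem_limitSet.1 (H.lim s o hoL (interior_subset ho))
  obtain ⟨a, ha⟩ := H.proper
  have haz : a ≠ z := fun h => ha 1 (one_mem _) s (by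
    rw [one_apply, h]
    exact H.lim_subset s hg.rep_mem)
  obtain ⟨n, hn⟩ := ((hg.tendsto haz).eventually (isOpen_interior.mem_nhds ho)).exists
  exact ha (g n) (H.le s (hg.1 n)) s (interior_subset hn)

end SignedPingPong

end PingPong

section DiscreteGroups

variable {M : Type*} [MetricSpace M] [CompactSpace M]

theorem IsDiscreteConvGroup.countable {G : Subgroup (M ≃ₜ M)} (hG : IsDiscreteConvGroup G)
    (h3 : ThreePoints M) : (G : Set (M ≃ₜ M)).Countable := by
  rcases isEmpty_or_nonempty M with hM | ⟨⟨x⟩⟩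
  · have : Subsingleton (M ≃ₜ M) := ⟨fun a b => Homeomorph.ext fun x => hM.elim x⟩
    exact Set.subsingleton_of_subsingleton.countable
  obtain ⟨y, hyx, -⟩ := h3 x x
  obtain ⟨z, hzx, hzy⟩ := h3 x y
  let T : ℕ → Set (M ≃ₜ M) := fun n => {g | g ∈ G ∧ 1 / ((n : ℝ) + 1) < dist (g y) (g x) ∧
    1 / ((n : ℝ) + 1) < dist (g z) (g x) ∧ 1 / ((n : ℝ) + 1) < dist (g z) (g y)}
  have hfin : ∀ n, (T n).Finite := by
    intro n
    by_contra hinf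
    let e := Set.Infinite.natEmbedding _ hinf
    obtain ⟨φ, hφ, b, c, hc⟩ := hG.exists_convIn (g := fun k => (e k : M ≃ₜ M))
      (fun k => (e k).2.1) (fun i j h => e.injective (Subtype.ext h))
    have hpos : (0 : ℝ) < 1 / ((n : ℝ) + 1) := by positivity
    have key : ∀ p q : M, p ≠ c → q ≠ c →
        (∀ k, 1 / ((n : ℝ) + 1) < dist ((e (φ k) : M ≃ₜ M) p) ((e (φ k) : M ≃ₜ M) q)) → False := by
      intro p q hp hq h
      have ht := (hc.tendsto hp).dist (hc.tendsto hq)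
      rw [dist_self] at ht
      obtain ⟨k, hk⟩ := (ht.eventually (gt_mem_nhds hpos)).exists
      exact lt_asymm hk (h k)
    by_cases hx : x = c
    · exact key z y (hx ▸ hzx) (hx ▸ hyx) fun k => (e (φ k)).2.2.2.2
    · by_cases hy : y = c
      · exact key z x (hy ▸ hzy) hx fun k => (e (φ k)).2.2.2.1
      · exact key y x hy hx fun k => (e (φ k)).2.2.1
  refine (countable_iUnion fun n => (hfin n).countable).mono fun g hg => ?_
  have h1 : 0 < dist (g y) (g x) := dist_pos.2 fun h => hyx (g.injective h)
  have h2 : 0 < dist (g z) (g x) := dist_pos.2 fun h => hzx (g.injective h)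
  have h4 : 0 < dist (g z) (g y) := dist_pos.2 fun h => hzy (g.injective h)
  obtain ⟨n, hn⟩ := exists_nat_one_div_lt (lt_min h1 (lt_min h2 h4))
  rw [lt_min_iff, lt_min_iff] at hn
  exact mem_iUnion.2 ⟨n, hg, hn⟩

theorem countable_isParabolicPt {G : Subgroup (M ≃ₜ M)} (hG : IsDiscreteConvGroup G)
    (h3 : ThreePoints M) : {x | IsParabolicPt G x}.Countable := by
  refine ((hG.countable h3).biUnion (t := fun p _ => {x : M | ∀ y, p y = y ↔ y = x})
    fun p _ => ?_).mono fun x hx => ?_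
  · exact Set.Subsingleton.countable fun x hx y hy => (hy x).1 ((hx x).2 rfl)
  · obtain ⟨p, hp, -, h⟩ := IsParabolicPt.exists_unique_fixed hx
    exact mem_iUnion₂.2 ⟨p, hp, h⟩

theorem TendstoHomeo.exists_tendsto_id {u : ℕ → M ≃ₜ M} (h : TendstoHomeo u) (x : M) :
    Tendsto (fun k => (u k)⁻¹ (u (k + 1) x)) atTop (𝓝 x) := by
  obtain ⟨a, ha⟩ := h
  rw [ContinuousMap.tendsto_iff_tendstoUniformly] at ha
  by_contra hn
  obtain ⟨φ, hφ, y, hy, ht⟩ := exists_subseq_tendsto_ne hn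
  have h1 : Tendsto (fun k => u (φ k) ((u (φ k))⁻¹ (u (φ k + 1) x))) atTop (𝓝 (a y)) := by
    refine (Metric.tendsto_atTop.2 fun ε hε => ?_)
    have e1 := hφ.tendsto_atTop.eventually (Metric.tendstoUniformly_iff.1 ha (ε / 2) (half_pos hε))
    have e2 := Metric.tendsto_nhds.1 ((a.continuous.tendsto y).comp ht) (ε / 2) (half_pos hε)
    refine eventually_atTop.1 ?_
    filter_upwards [e1, e2] with k h1 h2
    have h1' := h1 ((u (φ k))⁻¹ (u (φ k + 1) x))
    calc _ ≤ dist (u (φ k) ((u (φ k))⁻¹ (u (φ k + 1) x))) (a ((u (φ k))⁻¹ (u (φ k + 1) x))) +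
          dist (a ((u (φ k))⁻¹ (u (φ k + 1) x))) (a y) := dist_triangle _ _ _
      _ < ε / 2 + ε / 2 := add_lt_add (by rw [dist_comm]; exact h1') h2
      _ = ε := add_halves ε
  simp only [apply_inv_self] at h1
  have h2 : Tendsto (fun k => u k x) atTop (𝓝 (a x)) := ha.tendsto_at x
  have h4 := h2.comp ((tendsto_add_atTop_nat 1).comp hφ.tendsto_atTop)
  exact hy (a.injective (tendsto_nhds_unique h1 h4))

/-- Orbits of ordinary points are cocompact for the stabilizer of a non-conical point whose
stabilizer is cocompact on the limit set. -/
theorem exists_isClosed_orbit {G : Subgroup (M ≃ₜ M)} (hG : IsDiscreteConvGroup G) {o p : M}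
    (ho : o ∉ limitSet G) (hp : p ∈ limitSet G) (hpc : ¬IsConicalLimitPt G p) {K : Set M}
    (hK : IsClosed K) (hpK : p ∉ K)
    (hcov : ∀ x ∈ limitSet G, x ≠ p → ∃ h ∈ G, h p = p ∧ h x ∈ K) :
    ∃ K', IsClosed K' ∧ p ∉ K' ∧ ∀ g ∈ G, ∃ h ∈ G, h p = p ∧ h (g o) ∈ K' := by
  by_contra! hcon
  have hbad : ∀ n : ℕ, ∃ g ∈ G, ∀ h ∈ G, h p = p → h (g o) ∈ Metric.ball p (1 / ((n : ℝ) + 1)) := by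
    intro n
    obtain ⟨g, hg, h⟩ := hcon (Metric.ball p (1 / ((n : ℝ) + 1)))ᶜ Metric.isOpen_ball.isClosed_compl
      (by simp only [mem_compl_iff, not_not]; exact Metric.mem_ball_self (by positivity))
    exact ⟨g, hg, fun q hq hqp => by simpa using h q hq hqp⟩
  choose g hg hgb using hbad
  have hlim : ∀ h : ℕ → M ≃ₜ M, (∀ n, h n ∈ G) → (∀ n, h n p = p) → ∀ φ : ℕ → ℕ, StrictMono φ →
      Tendsto (fun n => h n (g (φ n) o)) atTop (𝓝 p) := by
    intro h hh hhp φ hφ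
    rw [tendsto_iff_dist_tendsto_zero]
    refine squeeze_zero (fun _ => dist_nonneg) (fun n => (hgb (φ n) (h n) (hh n) (hhp n)).le) ?_
    exact tendsto_one_div_add_atTop_nhds_zero_nat.comp hφ.tendsto_atTop
  by_cases hΛ : ∀ x ∈ limitSet G, x = p
  · have h1 : ∀ a ∈ G, a p = p := fun a ha => hΛ _ (apply_mem_limitSet ha hp)
    have h2 := hlim (fun n => (g n)⁻¹) (fun n => inv_mem (hg n)) (fun n => h1 _ (inv_mem (hg n)))
      id strictMono_id
    simp only [id, inv_apply_self] at h2
    exact ho ((tendsto_nhds_unique tendsto_const_nhds h2) ▸ hp)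
  push Not at hΛ
  obtain ⟨ξ₀, hξ₀, hξ₀p⟩ := hΛ
  obtain ⟨ζ, -, φ, hφ, hζ⟩ := isCompact_univ.tendsto_subseq (fun n => mem_univ ((g n)⁻¹ p))
  have key : ∀ ξ ∈ limitSet G, ξ = ζ := by
    intro ξ hξ
    by_contra hne
    have hev : ∀ᶠ n in atTop, g (φ n) ξ ≠ p := by
      filter_upwards [hζ.eventually_ne (Ne.symm hne)] with n hn h
      exact hn (inv_apply_eq.2 h.symm)
    obtain ⟨N, hN⟩ := eventually_atTop.1 hev
    choose q hq hqp hqK using fun n => hcov (g (φ (n + N)) ξ) (apply_mem_limitSet (hg _) hξ)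
      (hN (n + N) (Nat.le_add_left _ _))
    have hψ : StrictMono fun n => φ (n + N) := fun a b h => hφ (by omega)
    have ht := hlim q hq hqp _ hψ
    obtain ⟨χ, hχ, hc | hi⟩ := exists_strictMono_const_or_injective
      (fun n => q n * g (φ (n + N)))
    · obtain ⟨k, hk⟩ := hc
      have h1 : ∀ n, q (χ n) (g (φ (χ n + N)) o) = k o := fun n => by rw [← hk n]; rfl
      have h2 := ht.comp hχ.tendsto_atTop
      have h4 : k o = p := tendsto_nhds_unique (tendsto_const_nhds.congr fun n => (h1 n).symm) h2
      have hkG : k ∈ G := by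
        rw [← hk 0]
        exact mul_mem (hq _) (hg _)
      exact ho ((apply_mem_limitSet_iff hkG).1 (h4 ▸ hp))
    · obtain ⟨ω, hω, b, c, hbc⟩ := hG.exists_convIn
        (fun k => mul_mem (hq (χ k)) (hg (φ (χ k + N)))) hi
      have hoc : o ≠ c := fun h => ho (h ▸ hbc.rep_mem)
      have hb : b = p := tendsto_nhds_unique (hbc.tendsto hoc)
        (ht.comp (hχ.tendsto_atTop.comp hω.tendsto_atTop))
      have hcξ : ξ = c := by
        by_contra hne'
        exact hpK (hb ▸ hK.mem_of_tendsto (hbc.tendsto hne') (Eventually.of_forall fun n => hqK _))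
      have h1 := hbc.inv.tendsto_of_not_conical hpc
      have h2 := hζ.comp (((tendsto_add_atTop_nat N).comp hχ.tendsto_atTop).comp hω.tendsto_atTop)
      refine hne (hcξ.trans (tendsto_nhds_unique h1 (h2.congr fun n => ?_)))
      change (g (φ (χ (ω n) + N)))⁻¹ p = (q (χ (ω n)) * g (φ (χ (ω n) + N)))⁻¹ p
      rw [mul_inv_rev, mul_apply, inv_apply_eq.2 (hqp _).symm]
  exact hξ₀p ((key ξ₀ hξ₀).trans (key p hp).symm)

end DiscreteGroups

section PingPong

variable {M : Type*} [MetricSpace M] [CompactSpace M]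

namespace SignedPingPong

variable {G₀ G : Subgroup (M ≃ₜ M)} {J : Bool → Subgroup (M ≃ₜ M)}
    {F : Bool → M ≃ₜ M} {B : Bool → Set M} (H : SignedPingPong G₀ G J F B)
include H

theorem discrete_group (hG : IsConvGroup G) : IsDiscreteConvGroup G := by
  intro g hg hi
  obtain ⟨φ, hφ, hT | hc⟩ := hG g hg hi
  swap
  · exact ⟨φ, hφ, hc⟩
  exfalso
  set γ : ℕ → M ≃ₜ M := fun k => ((g ∘ φ) k)⁻¹ * (g ∘ φ) (k + 1) with hγ
  have hγG : ∀ k, γ k ∈ G := fun k => mul_mem (inv_mem (hg _)) (hg _)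
  have hγ1 : ∀ k, γ k ≠ 1 := fun k h => by
    have := hφ.injective (hi (inv_mul_eq_one.1 h))
    omega
  have hγt : ∀ x, Tendsto (fun k => γ k x) atTop (𝓝 x) := hT.exists_tendsto_id
  by_cases hfr : ∃ᶠ k in atTop, γ k ∈ G₀
  · obtain ⟨χ, hχ, hχG⟩ := extraction_of_frequently_atTop hfr
    obtain ⟨ω, hω, ⟨a, ha⟩ | hinj⟩ := exists_strictMono_const_or_injective (γ ∘ χ)
    · refine hγ1 (χ (ω 0)) ((ha 0).trans (Homeomorph.ext fun x => ?_))
      have h1 := (hγt x).comp (hχ.tendsto_atTop.comp hω.tendsto_atTop)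
      exact tendsto_nhds_unique (tendsto_const_nhds.congr fun n => by rw [← ha n]; rfl) h1
    · obtain ⟨ψ, hψ, b, c, hbc⟩ := H.discrete.exists_convIn (fun k => hχG (ω k)) hinj
      obtain ⟨z, hzb, hzc⟩ := H.threePoints b c
      exact hzb (tendsto_nhds_unique
        ((hγt z).comp (hχ.tendsto_atTop.comp (hω.tendsto_atTop.comp hψ.tendsto_atTop)))
        (hbc.tendsto hzc))
  · rw [not_frequently] at hfr
    obtain ⟨a, ha⟩ := H.proper
    have hb : ∀ s, ∀ᶠ k in atTop, ∃ b ∈ B s, γ k b ∈ B s := fun s => by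
      obtain ⟨b, hb⟩ := H.int_nonempty s
      filter_upwards [(hγt b).eventually (isOpen_interior.mem_nhds hb)] with k hk
      exact ⟨b, interior_subset hb, interior_subset hk⟩
    have hcl : IsClosed (B true ∪ B false) := (H.isClosed _).union (H.isClosed _)
    have hmem : a ∈ B true ∪ B false := by
      refine hcl.mem_of_tendsto (hγt a) ?_
      filter_upwards [hfr, hb true, hb false] with k hk h1 h2
      obtain ⟨s, h, t, κ, hred⟩ := (H.mem_or_red (hγG k)).resolve_left hk
      obtain ⟨b, hb, hγb⟩ : ∃ b ∈ B t, γ k b ∈ B t := by cases t <;> assumption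
      obtain ⟨rfl, hj⟩ := H.eq_of_mem hred.left_mem
        (H.red_apply hred (H.cross t κ hred.right_mem b hb)) hγb
      have h4 := H.inv _ _ hj _ (H.red_apply hred (ha κ hred.right_mem _))
      rw [apply_inv_self] at h4
      cases s
      exacts [Or.inr h4, Or.inl h4]
    rcases hmem with h | h
    exacts [ha 1 (one_mem _) _ h, ha 1 (one_mem _) _ h]

theorem exists_transversal (s : Bool) (hgf : IsGeomFinite (J s)) {X : Set M}
    (hX : ∀ j ∈ J s, ∀ x ∈ X, j x ∈ X)
    (hyp : ∀ ξ ∈ limitSet (J s), IsParabolicPt (J s) ξ →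
      ∃ K, IsClosed K ∧ ξ ∉ K ∧ ∀ x ∈ X, x ≠ ξ → ∃ p ∈ J s, p ξ = ξ ∧ p x ∈ K) :
    ∃ C, IsClosed C ∧ (∀ x ∈ C, x ∉ limitSet (J s)) ∧
      ∀ x ∈ X, x ∉ limitSet (J s) → ∃ j ∈ J s, j x ∈ C := by
  have hd : IsDiscreteConvGroup (J s) := H.discrete.mono (H.le s)
  refine exists_closed_transversal hd H.threePoints hX
    (countable_isParabolicPt hd H.threePoints) fun ξ hξ => (hgf ξ hξ).imp id fun h => ?_
  exact ⟨h.1, h.1.not_conical le_rfl hd H.threePoints, hyp ξ hξ h.1⟩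

theorem exists_transversal_limitSet (s : Bool) (hgf : IsGeomFinite (J s))
    (hyp : ∀ ξ ∈ limitSet (J s), IsParabolicPt (J s) ξ → IsBoundedParabolicPt G ξ) :
    ∃ C, IsClosed C ∧ (∀ x ∈ C, x ∉ limitSet (J s)) ∧
      ∀ x ∈ limitSet G, x ∉ limitSet (J s) → ∃ j ∈ J s, j x ∈ C := by
  refine H.exists_transversal s hgf
    (fun j hj x hx => apply_mem_limitSet (H.le_group (H.le s hj)) hx) fun ξ hξ hpar => ?_
  obtain ⟨-, K, hK, hKs, hcov⟩ := hyp ξ hξ hpar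
  refine ⟨K, hK.isClosed, fun h => (hKs h).2 rfl, fun x hx hne => ?_⟩
  obtain ⟨p, hp, hpξ, hpx⟩ := hcov x ⟨hx, hne⟩
  exact ⟨p, H.mem_J_of_fixed hp hξ hpξ, hpξ, hpx⟩

end SignedPingPong

end PingPong

section PingPong

variable {M : Type*} [MetricSpace M] [CompactSpace M]

theorem exists_strictMono_const {α : Type*} [Finite α] (u : ℕ → α) :
    ∃ φ : ℕ → ℕ, StrictMono φ ∧ ∃ a, ∀ n, u (φ n) = a := by
  obtain ⟨φ, hφ, h | h⟩ := exists_strictMono_const_or_injective u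
  · exact ⟨φ, hφ, h⟩
  · exact (not_injective_infinite_finite _ h).elim

namespace SignedPingPong

variable {G₀ G : Subgroup (M ≃ₜ M)} {J : Bool → Subgroup (M ≃ₜ M)}
    {F : Bool → M ≃ₜ M} {B : Bool → Set M} (H : SignedPingPong G₀ G J F B)
include H

/-- A conical limit point of `G` in the limit set of `G₀`, outside of the translates of the
sets `B s`, is conical for `G₀`. -/
theorem isConicalLimitPt_of_not_mem (hGd : IsDiscreteConvGroup G)
    (hC : ∀ s, ∃ C, IsClosed C ∧ (∀ x ∈ C, x ∉ limitSet (J s)) ∧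
      ∀ x ∈ limitSet G, x ∉ limitSet (J s) → ∃ j ∈ J s, j x ∈ C)
    {x : M} (hx : x ∈ limitSet G₀) (hcon : IsConicalLimitPt G x)
    (hxB : ∀ h ∈ G₀, ∀ s, h x ∉ B s) : IsConicalLimitPt G₀ x := by
  obtain ⟨g, a, b, hg, ha, hab⟩ := hcon.exists_convIn hGd H.threePoints
  obtain ⟨φ, hφ, ⟨q, hq⟩ | hinj⟩ :=
    exists_strictMono_const_or_injective (fun k => (g k : (M ≃ₜ M) ⧸ G₀))
  · have hmem : ∀ k, (g (φ 0))⁻¹ * g (φ k) ∈ G₀ := fun k =>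
      QuotientGroup.eq.1 ((hq 0).trans (hq k).symm)
    have h1 := (hg.comp hφ).mul_left (inv_mem (hg.1 (φ 0)))
    have h2 : ConvIn G₀ (fun k => (g (φ 0))⁻¹ * g (φ k)) ((g (φ 0))⁻¹ b) x :=
      ⟨hmem, h1.2.1, h1.2.2⟩
    refine isConicalLimitPt_of_convIn_same h2
      ((((g (φ 0))⁻¹).continuous.tendsto a).comp (ha.comp hφ.tendsto_atTop))
      fun h => hab (((g (φ 0))⁻¹).injective h)
  -- distinct cosets
  obtain ⟨N, hN⟩ : ∃ N, ∀ k, g (φ (k + N)) ∉ G₀ := by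
    by_cases h : ∃ n, g (φ n) ∈ G₀
    · obtain ⟨n, hn⟩ := h
      refine ⟨n + 1, fun k hk => ?_⟩
      have : (g (φ (k + (n + 1))) : (M ≃ₜ M) ⧸ G₀) = g (φ n) :=
        QuotientGroup.eq.2 (mul_mem (inv_mem hk) hn)
      have := hinj this
      omega
    · push Not at h
      exact ⟨0, fun k => h _⟩
  choose s h t κ hred using fun k => (H.mem_or_red (hg.1 (φ (k + N)))).resolve_left (hN k)
  obtain ⟨χ, hχ, ⟨s₀, t₀⟩, hst⟩ := exists_strictMono_const (fun k => (s k, t k))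
  have hs : ∀ k, s (χ k) = s₀ := fun k => congrArg Prod.fst (hst k)
  have ht : ∀ k, t (χ k) = t₀ := fun k => congrArg Prod.snd (hst k)
  set ψ : ℕ → ℕ := fun k => φ (χ k + N) with hψ
  have hψm : StrictMono ψ := fun i j hij => hφ (by have := hχ hij; omega)
  have hred' : ∀ k, Red G₀ J F s₀ (h (χ k)) t₀ (κ (χ k)) (g (ψ k)) := fun k => by
    have := hred (χ k)
    rwa [hs, ht] at this
  obtain ⟨C, hCcl, hCΛ, hCcov⟩ := hC (!t₀)
  have hκΛ : ∀ k, κ (χ k) x ∈ limitSet G₀ := fun k => apply_mem_limitSet (hred _).right_mem hx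
  choose j hj hjC using fun k => hCcov (κ (χ k) x) (limitSet_mono H.le_group (hκΛ k))
    fun hmem => hxB _ (hred _).right_mem _ (H.lim_subset _ hmem)
  set κ' : ℕ → M ≃ₜ M := fun k => j k * κ (χ k) with hκ'
  have hκ'G : ∀ k, κ' k ∈ G₀ := fun k => mul_mem (H.le _ (hj k)) (hred _).right_mem
  set v : ℕ → M ≃ₜ M := fun k => g (ψ k) * (κ' k)⁻¹ with hv
  have hvg : ∀ k, g (ψ k) = v k * κ' k := fun k => by simp [hv]
  have hvinj : Function.Injective v := fun m n hmn => by
    have h1 : (g (ψ m) : (M ≃ₜ M) ⧸ G₀) = g (ψ n) := by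
      refine QuotientGroup.eq.2 ?_
      have : (g (ψ m))⁻¹ * g (ψ n) = (κ' m)⁻¹ * κ' n := by
        rw [hvg m, hvg n, hmn]
        group
      rw [this]
      exact mul_mem (inv_mem (hκ'G _)) (hκ'G _)
    have h2 := hinj h1
    exact hχ.injective (by omega)
  have hvred : ∀ k, Red G₀ J F s₀ (h (χ k)) t₀ (j k)⁻¹ (v k) := fun k => by
    have h1 := (hred' k).mul_right (inv_mem (hκ'G k))
    have h2 : κ (χ k) * (κ' k)⁻¹ = (j k)⁻¹ := by simp [hκ']
    rwa [h2] at h1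
  -- the inverses send points outside of the first set into the last one
  have hvB : ∀ k z, (h (χ k))⁻¹ z ∉ B s₀ → (v k)⁻¹ z ∈ B (!t₀) := fun k z hz => by
    by_contra hn
    have := H.red_apply (hvred k) (z := (v k)⁻¹ z)
      (fun hmem => hn ((H.inv_iff _ (inv_mem (hj k))).1 hmem))
    rw [apply_inv_self] at this
    exact hz this
  obtain ⟨ω, hω, α, β, hαβ⟩ := hGd.exists_convIn
    (fun k => mul_mem (hg.1 _) (inv_mem (H.le_group (hκ'G k)))) hvinj
  have hβ : β ∈ B (!t₀) := by
    obtain ⟨p, hp⟩ := H.proper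
    obtain ⟨q, hq⟩ := H.int_nonempty (!s₀)
    replace hq := interior_subset hq
    have hpq : p ≠ q := fun h => hp 1 (one_mem _) (!s₀) (h ▸ hq)
    have key : ∀ z, z ≠ α → (∀ k, (h (χ k))⁻¹ z ∉ B s₀) → β ∈ B (!t₀) := fun z hz hzB =>
      (H.isClosed _).mem_of_tendsto (hαβ.inv.tendsto hz)
        (Eventually.of_forall fun k => hvB _ _ (hzB _))
    by_cases hpα : p = α
    · refine key q (fun h => hpq (hpα.trans h.symm)) fun k => ?_
      have := H.cross (!s₀) _ (inv_mem (hred (χ k)).left_mem) q hq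
      rwa [Bool.not_not] at this
    · exact key p hpα fun k => hp _ (inv_mem (hred (χ k)).left_mem) _
  obtain ⟨c, -, ρ, hρ, hc⟩ := isCompact_univ.tendsto_subseq (fun k => mem_univ (κ' (ω k) x))
  have hcC : c ∈ C := hCcl.mem_of_tendsto hc (Eventually.of_forall fun k => hjC _)
  have hcΛ : c ∈ limitSet G₀ := (isClosed_limitSet H.discrete H.threePoints).mem_of_tendsto hc
    (Eventually.of_forall fun k => apply_mem_limitSet (hκ'G _) hx)
  have hcβ : c ≠ β := fun h => hCΛ c hcC (H.lim _ c hcΛ (h ▸ hβ))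
  have hαβ' := hαβ.comp hρ
  have hg' : ConvIn G (fun k => g (ψ (ω (ρ k)))) b x :=
    hg.comp (φ := ψ ∘ ω ∘ ρ) (hψm.comp (hω.comp hρ))
  have ha' : Tendsto (fun k => g (ψ (ω (ρ k))) x) atTop (𝓝 a) :=
    ha.comp (hψm.comp (hω.comp hρ)).tendsto_atTop
  have hαa : α = a := by
    refine tendsto_nhds_unique (hαβ'.tendsto_of_tendsto hc hcβ) (ha'.congr fun k => ?_)
    rw [hvg]
    rfl
  obtain ⟨σ, hσ, ⟨q, hq⟩ | hσi⟩ := exists_strictMono_const_or_injective (κ' ∘ ω ∘ ρ)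
  · exfalso
    obtain ⟨z, hzx, hzβ⟩ := H.threePoints x (q⁻¹ β)
    have h1 := (hαβ'.comp hσ).tendsto (x := q z) fun h => hzβ (by rw [← h, inv_apply_self])
    refine hab (hαa ▸ tendsto_nhds_unique h1
      (((hg'.comp hσ).tendsto hzx).congr fun k => ?_))
    change g (ψ (ω (ρ (σ k)))) z = v (ω (ρ (σ k))) (q z)
    rw [hvg, ← hq k]
    rfl
  · obtain ⟨τ, hτ, c', d, hcd⟩ := H.discrete.exists_convIn (fun k => hκ'G (ω (ρ (σ k)))) hσi
    have hct := hc.comp (hσ.comp hτ).tendsto_atTop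
    by_cases hcc : c = c'
    · exfalso
      obtain ⟨z, hzx, hzd⟩ := H.threePoints x d
      have h1 := (hαβ'.comp (hσ.comp hτ)).tendsto_of_tendsto (hcd.tendsto hzd) (hcc ▸ hcβ)
      refine hab (hαa ▸ tendsto_nhds_unique h1
        (((hg'.comp (hσ.comp hτ)).tendsto hzx).congr fun k => ?_))
      change g (ψ (ω (ρ (σ (τ k))))) z = v _ (κ' _ z)
      rw [hvg]
      rfl
    · exact isConicalLimitPt_of_convIn hcd hct hcc

theorem isBoundedParabolicPt_of_group {x : M} (hx : x ∈ limitSet G₀)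
    (h : IsBoundedParabolicPt G x) : IsBoundedParabolicPt G₀ x := by
  obtain ⟨⟨g, hg, hgp, hgx⟩, K, hK, hKs, hcov⟩ := h
  refine ⟨⟨g, H.mem_of_fixed hg hx hgx, hgp, hgx⟩, K ∩ limitSet G₀,
    hK.inter_right (isClosed_limitSet H.discrete H.threePoints),
    fun y hy => ⟨hy.2, (hKs hy.1).2⟩, fun y hy => ?_⟩
  obtain ⟨q, hq, hqx, hqy⟩ := hcov y ⟨limitSet_mono H.le_group hy.1, hy.2⟩
  have hq₀ := H.mem_of_fixed hq hx hqx
  exact ⟨q, hq₀, hqx, hqy, apply_mem_limitSet hq₀ hy.1⟩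

theorem isGeomFinite_base (hGd : IsDiscreteConvGroup G) (hJ : ∀ s, IsGeomFinite (J s))
    (hG : IsGeomFinite G) : IsGeomFinite G₀ := by
  have hpar : ∀ s, ∀ ξ ∈ limitSet (J s), IsParabolicPt (J s) ξ → IsBoundedParabolicPt G ξ :=
    fun s ξ hξ hp => (hG ξ (limitSet_mono H.le_group (H.limitSet_le s hξ))).resolve_left
      (hp.not_conical ((H.le s).trans H.le_group) hGd H.threePoints)
  intro x hx
  rcases hG x (limitSet_mono H.le_group hx) with hcon | hb
  · refine Or.inl ?_
    by_cases hxB : ∀ h ∈ G₀, ∀ s, h x ∉ B s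
    · exact H.isConicalLimitPt_of_not_mem hGd
        (fun s => H.exists_transversal_limitSet s (hJ s) (hpar s)) hx hcon hxB
    · push Not at hxB
      obtain ⟨h, hh, s, hs⟩ := hxB
      have hξ := H.lim s _ (apply_mem_limitSet hh hx) hs
      refine (isConicalLimitPt_apply_iff hh).1 ?_
      rcases hJ s _ hξ with hc | hp
      · exact hc.mono (H.le s)
      · exact (hp.1.not_conical ((H.le s).trans H.le_group) hGd H.threePoints
          (hcon.apply (H.le_group hh))).elim
  · exact Or.inr (H.isBoundedParabolicPt_of_group hx hb)

end SignedPingPong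

end PingPong

section PingPong

variable {M : Type*} [MetricSpace M] [CompactSpace M]

/-- The sequence `x` cannot be moved away from `p` by the stabilizer of `p` in `G`. -/
def Escapes (G : Subgroup (M ≃ₜ M)) (p : M) (x : ℕ → M) : Prop :=
  ∀ U ∈ 𝓝 p, ∀ᶠ k in atTop, ∀ h ∈ G, h p = p → h (x k) ∈ U

theorem Escapes.comp {G : Subgroup (M ≃ₜ M)} {p : M} {x : ℕ → M} (h : Escapes G p x)
    {φ : ℕ → ℕ} (hφ : StrictMono φ) : Escapes G p (x ∘ φ) := fun U hU =>
  hφ.tendsto_atTop.eventually (h U hU)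

theorem Escapes.apply {G : Subgroup (M ≃ₜ M)} {p : M} {x : ℕ → M} (h : Escapes G p x)
    {a : M ≃ₜ M} (ha : ∀ q ∈ G, q (a p) = a p → a⁻¹ * q * a ∈ G) :
    Escapes G (a p) fun k => a (x k) := by
  intro U hU
  filter_upwards [h _ (a.continuous.continuousAt.preimage_mem_nhds hU)] with k hk q hq hqp
  have := hk _ (ha q hq hqp) (by simp only [mul_apply, hqp, inv_apply_self])
  simpa only [mul_apply, mem_preimage, apply_inv_self] using this

/-- Translates of the sets `B s` shrink to limit points. -/
def Shrinks (G₀ : Subgroup (M ≃ₜ M)) (J : Bool → Subgroup (M ≃ₜ M)) (B : Bool → Set M) : Prop :=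
  ∀ s, ∀ h : ℕ → M ≃ₜ M, (∀ k, h k ∈ G₀) →
    Function.Injective (fun k => (h k : (M ≃ₜ M) ⧸ J s)) →
    ∃ φ : ℕ → ℕ, StrictMono φ ∧ ∃ z ∈ limitSet G₀, ∀ U ∈ 𝓝 z, ∀ᶠ k in atTop,
      ∀ x ∈ B s, h (φ k) x ∈ U

namespace SignedPingPong

variable {G₀ G : Subgroup (M ≃ₜ M)} {J : Bool → Subgroup (M ≃ₜ M)}
    {F : Bool → M ≃ₜ M} {B : Bool → Set M} (H : SignedPingPong G₀ G J F B)
include H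

theorem shrinks (hJ : ∀ s, IsGeomFinite (J s)) (hG₀ : IsGeomFinite G₀) : Shrinks G₀ J B := by
  intro s h hh hinj
  obtain ⟨o, hoB, ho⟩ := H.exists_mem_not_limitSet s
  obtain ⟨C, hCcl, hCΛ, hCcov⟩ := H.exists_transversal s (hJ s) (X := {x | ∃ g ∈ G₀, g o = x})
    (by
      rintro j hj _ ⟨g, hg, rfl⟩
      exact ⟨j * g, mul_mem (H.le s hj) hg, rfl⟩)
    (fun ξ hξ hp => by
      have hnc := hp.not_conical (H.le s) H.discrete H.threePoints
      obtain ⟨-, K, hK, hKs, hcov⟩ := (hG₀ ξ (H.limitSet_le s hξ)).resolve_left hnc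
      obtain ⟨K', hK', hξK', hcov'⟩ := exists_isClosed_orbit H.discrete ho (H.limitSet_le s hξ) hnc
        hK.isClosed (fun h => (hKs h).2 rfl) fun x hx hne => hcov x ⟨hx, hne⟩
      refine ⟨K', hK', hξK', ?_⟩
      rintro _ ⟨g, hg, rfl⟩ -
      obtain ⟨q, hq, hqξ, hqK⟩ := hcov' g hg
      exact ⟨q, H.mem_J_of_fixed (H.le_group hq) hξ hqξ, hqξ, hqK⟩)
  choose j hj hjC using fun k => hCcov ((h k)⁻¹ o) ⟨_, inv_mem (hh k), rfl⟩ fun hmem =>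
    ho ((apply_mem_limitSet_iff (inv_mem (hh k))).1 (H.limitSet_le s hmem))
  have hgi : Function.Injective fun k => h k * (j k)⁻¹ := fun m n hmn => hinj <| by
    refine QuotientGroup.eq.2 ?_
    have h1 : h m * (j m)⁻¹ = h n * (j n)⁻¹ := hmn
    have : (h m)⁻¹ * h n = (j m)⁻¹ * j n := by
      rw [inv_mul_eq_iff_eq_mul, ← mul_assoc, h1]
      group
    rw [this]
    exact mul_mem (inv_mem (hj m)) (hj n)
  obtain ⟨φ, hφ, z, w, hzw⟩ := H.discrete.exists_convIn
    (fun k => mul_mem (hh k) (inv_mem (H.le s (hj k)))) hgi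
  have hwC : w ∈ C := by
    refine hCcl.mem_of_tendsto (hzw.inv.tendsto (x := o) fun h => ho (h ▸ hzw.attr_mem))
      (Eventually.of_forall fun k => ?_)
    have := hjC (φ k)
    simpa [mul_inv_rev, mul_apply] using this
  have hwB : w ∉ B s := fun h => hCΛ w hwC (H.lim s w hzw.rep_mem h)
  refine ⟨φ, hφ, z, hzw.attr_mem, fun U hU => ?_⟩
  filter_upwards [hzw.2.2 (B s) (H.isClosed s).isCompact hwB U hU] with k hk x hx
  have := hk (j (φ k) x) (H.inv s _ (hj _) x hx)
  simpa only [Function.comp, mul_apply, inv_apply_self] using this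

variable (hsh : Shrinks G₀ J B)
include hsh

theorem limitSet_cases {u : ℕ → M ≃ₜ M} {x z : M} (hu : ConvIn G u x z) :
    x ∈ limitSet G₀ ∨ ∃ s, ∃ h ∈ G₀, h⁻¹ x ∈ B s ∧ ∃ φ : ℕ → ℕ, StrictMono φ ∧
      ∀ k, ∃ v, Tail G₀ J F s v ∧ u (φ k) = h * F s * v := by
  by_cases hfr : ∃ᶠ k in atTop, u k ∈ G₀
  · obtain ⟨φ, hφ, hφG⟩ := extraction_of_frequently_atTop hfr
    exact Or.inl (ConvIn.attr_mem ⟨hφG, hu.2.1.comp hφ.injective, hu.2.2.comp hφ⟩)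
  rw [not_frequently, eventually_atTop] at hfr
  obtain ⟨N, hN⟩ := hfr
  choose s h t κ hred using fun k => (H.mem_or_red (hu.1 (k + N))).resolve_left
    (hN (k + N) (Nat.le_add_left _ _))
  obtain ⟨χ, hχ, ⟨s₀, t₀⟩, hst⟩ := exists_strictMono_const (fun k => (s k, t k))
  have hs : ∀ k, s (χ k) = s₀ := fun k => congrArg Prod.fst (hst k)
  have ht : ∀ k, t (χ k) = t₀ := fun k => congrArg Prod.snd (hst k)
  have hψ : StrictMono fun k => χ k + N := fun i j hij => Nat.add_lt_add_right (hχ hij) N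
  have hred' : ∀ k, Red G₀ J F s₀ (h (χ k)) t₀ (κ (χ k)) (u (χ k + N)) := fun k => by
    have := hred (χ k)
    rwa [hs, ht] at this
  -- a test point
  obtain ⟨w, hwz, hw⟩ : ∃ w, w ≠ z ∧ ∀ k, κ (χ k) w ∉ B (!t₀) := by
    obtain ⟨p, hp⟩ := H.proper
    by_cases hpz : p = z
    · obtain ⟨q, hq⟩ := H.int_nonempty t₀
      replace hq := interior_subset hq
      exact ⟨q, fun h => hp 1 (one_mem _) t₀ ((hpz.trans h.symm) ▸ hq),
        fun k => H.cross t₀ _ (hred _).right_mem q hq⟩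
    · exact ⟨p, hpz, fun k => hp _ (hred _).right_mem _⟩
  have hut := (hu.comp hψ).tendsto hwz
  have hmem : ∀ k, (h (χ k))⁻¹ (u (χ k + N) w) ∈ B s₀ := fun k => H.red_apply (hred' k) (hw k)
  obtain ⟨ω, hω, ⟨q, hq⟩ | hinj⟩ :=
    exists_strictMono_const_or_injective (fun k => (h (χ k) : (M ≃ₜ M) ⧸ J s₀))
  · refine Or.inr ⟨s₀, h (χ (ω 0)), (hred _).left_mem, ?_, fun k => χ (ω k) + N,
      hψ.comp hω, fun k => ?_⟩
    · refine (H.isClosed s₀).mem_of_tendsto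
        (((h (χ (ω 0)))⁻¹.continuous.tendsto x).comp (hut.comp hω.tendsto_atTop))
        (Eventually.of_forall fun k => ?_)
      have hj := QuotientGroup.eq.1 ((hq 0).trans (hq k).symm)
      have := H.inv s₀ _ hj _ (hmem (ω k))
      rwa [mul_apply, apply_inv_self] at this
    · have hj := QuotientGroup.eq.1 ((hq 0).trans (hq k).symm)
      obtain ⟨v, hv, huv⟩ := (hred' (ω k)).exists_tail
      have hj' : (F s₀)⁻¹ * ((h (χ (ω 0)))⁻¹ * h (χ (ω k))) * F s₀ ∈ J (!s₀) := by
        have := H.conj' (!s₀) (j := (h (χ (ω 0)))⁻¹ * h (χ (ω k))) (by rwa [Bool.not_not])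
        rwa [Bool.not_not, H.F_not] at this
      refine ⟨_, hv.mul_left H.le hj', ?_⟩
      rw [huv]
      group
  · obtain ⟨ρ, hρ, ζ, hζ, hζU⟩ := hsh s₀ _ (fun k => (hred (χ (ω k))).left_mem) hinj
    have h1 : Tendsto (fun k => u (χ (ω (ρ k)) + N) w) atTop (𝓝 ζ) := fun U hU => by
      refine mem_map.2 ?_
      filter_upwards [hζU U hU] with k hk
      have := hk _ (hmem (ω (ρ k)))
      rwa [apply_inv_self] at this
    have := tendsto_nhds_unique h1 (hut.comp (hω.comp hρ).tendsto_atTop)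
    exact Or.inl (this ▸ hζ)

theorem limitSet_cover {x : M} (hx : x ∈ limitSet G) :
    x ∈ limitSet G₀ ∨ ∃ s, ∃ h ∈ G₀, h⁻¹ x ∈ B s := by
  obtain ⟨u, z, hu⟩ := mem_limitSet.1 hx
  exact (H.limitSet_cases hsh hu).imp id fun ⟨s, h, hh, hxs, _⟩ => ⟨s, h, hh, hxs⟩

/-- Limit points of `G` on the common boundary of `B s` and `F s (B (!s))` are limit points of
`J s`. -/
theorem mem_limitSet_of_mem_of_mem {x : M} (hx : x ∈ limitSet G) {s : Bool} (hxs : x ∈ B s)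
    (hxs' : F (!s) x ∈ B (!s)) : x ∈ limitSet (J s) := by
  obtain ⟨u, z, hu⟩ := mem_limitSet.1 hx
  rcases H.limitSet_cases hsh hu with h | ⟨s', h, hh, hxB, φ, hφ, hv⟩
  · exact H.lim s x h hxs
  obtain ⟨rfl, hhJ⟩ := H.eq_of_mem hh hxB hxs
  have hj : (F s')⁻¹ * h * F s' ∈ J (!s') := by
    have := H.conj' (!s') (j := h) (by rwa [Bool.not_not])
    rwa [Bool.not_not, H.F_not] at this
  have hv' : ∀ k, Tail G₀ J F s' ((F s')⁻¹ * u (φ k)) := fun k => by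
    obtain ⟨v, hv, huv⟩ := hv k
    have h1 : (F s')⁻¹ * u (φ k) = (F s')⁻¹ * h * F s' * v := by
      rw [huv]
      simp only [mul_assoc]
    rw [h1]
    exact hv.mul_left H.le hj
  have hcv := (hu.comp hφ).mul_left (inv_mem (H.F_mem s'))
  rcases H.limitSet_cases hsh hcv with h1 | ⟨s'', h', hh', hyB, ψ, hψ, hw⟩
  · rw [← H.F_not] at h1
    have := H.F_limitSet s' (H.lim _ _ h1 hxs')
    rwa [H.F_apply_not] at this
  · exfalso
    rw [← H.F_not] at hyB
    obtain ⟨rfl, hh'J⟩ := H.eq_of_mem hh' hyB hxs'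
    obtain ⟨w, hw, huw⟩ := hw 0
    obtain ⟨a, ha⟩ := H.proper
    refine H.tail_apply_base (hv' (ψ 0)) ha ?_
    have huw' : (F s')⁻¹ * u (φ (ψ 0)) = h' * F (!s') * w := huw
    rw [huw', mul_apply, mul_apply]
    exact H.inv _ _ hh'J _ (H.mapsTo _ _ (H.tail_apply_base hw ha))

/-- The key case of the cocompactness of the stabilizer of a bounded parabolic point. -/
theorem not_escapes_of_avoids {p : M} (hp : p ∈ limitSet G₀) (hpb : IsBoundedParabolicPt G₀ p)
    {x : ℕ → M} (hxp : ∀ k, x k ≠ p) (hesc : Escapes G₀ p x)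
    (hcase : ∀ k, x k ∈ limitSet G₀ ∨ ∃ s, ∃ g ∈ G₀, g⁻¹ (x k) ∈ B s ∧ g⁻¹ p ∉ B s) : False := by
  have hpc := hpb.1.not_conical le_rfl H.discrete H.threePoints
  obtain ⟨-, K, hK, hKs, hcov⟩ := hpb
  have hKp : p ∉ K := fun h => (hKs h).2 rfl
  have hev := hesc Kᶜ (hK.isClosed.isOpen_compl.mem_nhds hKp)
  obtain ⟨N, hN⟩ := eventually_atTop.1 hev
  have hcase' : ∀ k, ∃ s, ∃ g ∈ G₀, g⁻¹ (x (k + N)) ∈ B s ∧ g⁻¹ p ∉ B s := fun k => by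
    refine (hcase (k + N)).resolve_left fun hxΛ => ?_
    obtain ⟨q, hq, hqp, hqK⟩ := hcov _ ⟨hxΛ, hxp _⟩
    exact hN (k + N) (Nat.le_add_left _ _) q hq hqp hqK
  choose s g hg hgx hgp using hcase'
  obtain ⟨χ, hχ, s₀, hs⟩ := exists_strictMono_const s
  obtain ⟨o, hoB, ho⟩ := H.exists_mem_not_limitSet s₀
  obtain ⟨K', hK', hpK', hcov'⟩ := exists_isClosed_orbit H.discrete ho hp hpc hK.isClosed hKp
    fun x hx hne => hcov x ⟨hx, hne⟩
  choose q hq hqp hqK using fun k => hcov' (g (χ k)) (hg _)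
  have hψ : StrictMono fun k => χ k + N := fun i j hij => Nat.add_lt_add_right (hχ hij) N
  have hlim : Tendsto (fun k => q k (x (χ k + N))) atTop (𝓝 p) := fun U hU => by
    refine mem_map.2 ?_
    filter_upwards [hψ.tendsto_atTop.eventually (hesc U hU)] with k hk
    exact hk _ (hq k) (hqp k)
  have hmem : ∀ k, (q k * g (χ k))⁻¹ (q k (x (χ k + N))) ∈ B s₀ := fun k => by
    have := hgx (χ k)
    rw [hs] at this
    rwa [mul_inv_rev, mul_apply, inv_apply_self]
  obtain ⟨ω, hω, ⟨r, hr⟩ | hinj⟩ := exists_strictMono_const_or_injective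
    (fun k => ((q k * g (χ k) : M ≃ₜ M) : (M ≃ₜ M) ⧸ J s₀))
  · set a : M ≃ₜ M := q (ω 0) * g (χ (ω 0)) with ha
    have h1 : a⁻¹ p ∈ B s₀ := by
      refine (H.isClosed s₀).mem_of_tendsto
        ((a⁻¹.continuous.tendsto p).comp (hlim.comp hω.tendsto_atTop))
        (Eventually.of_forall fun k => ?_)
      have hj := QuotientGroup.eq.1 ((hr 0).trans (hr k).symm)
      have := H.inv s₀ _ hj _ (hmem (ω k))
      rwa [mul_apply, apply_inv_self] at this
    refine hgp (χ (ω 0)) ?_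
    rw [hs]
    rwa [ha, mul_inv_rev, mul_apply, inv_apply_eq.2 (hqp _).symm] at h1
  · obtain ⟨ρ, hρ, ζ, hζ, hζU⟩ := hsh s₀ _ (fun k => mul_mem (hq (ω k)) (hg (χ (ω k)))) hinj
    have h1 : Tendsto (fun k => q (ω (ρ k)) (x (χ (ω (ρ k)) + N))) atTop (𝓝 ζ) := fun U hU => by
      refine mem_map.2 ?_
      filter_upwards [hζU U hU] with k hk
      have := hk _ (hmem (ω (ρ k)))
      rwa [apply_inv_self] at this
    have h2 : Tendsto (fun k => q (ω (ρ k)) (g (χ (ω (ρ k))) o)) atTop (𝓝 ζ) := fun U hU => by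
      refine mem_map.2 ?_
      filter_upwards [hζU U hU] with k hk
      exact hk o hoB
    have h3 : ζ = p := tendsto_nhds_unique h1 (hlim.comp (hω.comp hρ).tendsto_atTop)
    exact hpK' (h3 ▸ hK'.mem_of_tendsto h2 (Eventually.of_forall fun k => hqK _))

end SignedPingPong

end PingPong

section PingPong

variable {M : Type*} [MetricSpace M] [CompactSpace M]

namespace SignedPingPong

variable {G₀ G : Subgroup (M ≃ₜ M)} {J : Bool → Subgroup (M ≃ₜ M)}
    {F : Bool → M ≃ₜ M} {B : Bool → Set M} (H : SignedPingPong G₀ G J F B)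
include H

theorem not_escapes_of_mem (hsh : Shrinks G₀ J B) (hG₀ : IsGeomFinite G₀) {p : M} {s : Bool}
    (hp : p ∈ limitSet G₀) (hpb : IsBoundedParabolicPt G₀ p) (hps : p ∈ B s) {x : ℕ → M}
    (hxs : ∀ k, x k ∈ B s) (hxG : ∀ k, x k ∈ limitSet G) (hxG₀ : ∀ k, x k ∉ limitSet G₀)
    (hesc : Escapes G₀ p x) : False := by
  have hFG := H.F_mem (!s)
  have hp' : F (!s) p ∈ limitSet (J (!s)) := H.F_limitSet (!s) (by
    rw [Bool.not_not]
    exact H.lim s p hp hps)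
  have hpΛ := H.limitSet_le _ hp'
  have hpar : IsParabolicPt G₀ (F (!s) p) := by
    obtain ⟨g, hg, hgp, hgx⟩ := (hpb.1.mono H.le_group).apply hFG
    exact ⟨g, H.mem_of_fixed hg hpΛ hgx, hgp, hgx⟩
  have hpb' := (hG₀ _ hpΛ).resolve_left (hpar.not_conical le_rfl H.discrete H.threePoints)
  refine H.not_escapes_of_avoids hsh hpΛ hpb' (x := fun k => F (!s) (x k))
    (fun k h => hxG₀ k ((F (!s)).injective h ▸ hp))
    (hesc.apply fun q hq hqp => H.mem_of_fixed
      (mul_mem (mul_mem (inv_mem hFG) (H.le_group hq)) hFG) hp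
      (by simp only [mul_apply, hqp, inv_apply_self])) fun k => ?_
  refine (H.limitSet_cover hsh (apply_mem_limitSet hFG (hxG k))).imp id ?_
  rintro ⟨s', g, hg, hgx⟩
  refine ⟨s', g, hg, hgx, fun hgp => ?_⟩
  obtain ⟨rfl, hgJ⟩ := H.eq_of_mem hg hgp (H.lim_subset _ hp')
  have h1 := H.inv _ _ hgJ _ hgx
  rw [apply_inv_self] at h1
  exact hxG₀ k (H.limitSet_le s (H.mem_limitSet_of_mem_of_mem hsh (hxG k) (hxs k) h1))

theorem not_escapes (hsh : Shrinks G₀ J B) (hG₀ : IsGeomFinite G₀) {p : M}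
    (hp : p ∈ limitSet G₀) (hpb : IsBoundedParabolicPt G₀ p) {x : ℕ → M}
    (hxG : ∀ k, x k ∈ limitSet G) (hxp : ∀ k, x k ≠ p) (hesc : Escapes G₀ p x) : False := by
  by_cases hfr : ∃ᶠ k in atTop, x k ∈ limitSet G₀ ∨ ∃ s, ∃ g ∈ G₀, g⁻¹ (x k) ∈ B s ∧ g⁻¹ p ∉ B s
  · obtain ⟨φ, hφ, h⟩ := extraction_of_frequently_atTop hfr
    exact H.not_escapes_of_avoids hsh hp hpb (fun k => hxp (φ k)) (hesc.comp hφ) h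
  rw [not_frequently, eventually_atTop] at hfr
  obtain ⟨N, hN⟩ := hfr
  have hΛ : ∀ k, x (k + N) ∉ limitSet G₀ := fun k h => hN _ (Nat.le_add_left _ _) (Or.inl h)
  have hbad : ∀ k, ∃ s, ∃ g ∈ G₀, g⁻¹ (x (k + N)) ∈ B s ∧ g⁻¹ p ∈ B s := fun k => by
    obtain ⟨s, g, hg, hgx⟩ := (H.limitSet_cover hsh (hxG (k + N))).resolve_left (hΛ k)
    refine ⟨s, g, hg, hgx, ?_⟩
    by_contra hgp
    exact hN _ (Nat.le_add_left _ _) (Or.inr ⟨s, g, hg, hgx, hgp⟩)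
  choose s g hg hgx hgp using hbad
  have hinv := inv_mem (hg 0)
  refine H.not_escapes_of_mem hsh hG₀ (apply_mem_limitSet hinv hp) (hpb.apply hinv) (hgp 0)
    (x := fun k => (g 0)⁻¹ (x (k + N))) (fun k => ?_)
    (fun k => apply_mem_limitSet (H.le_group hinv) (hxG _))
    (fun k h => hΛ k ((apply_mem_limitSet_iff hinv).1 h))
    ((hesc.comp (φ := fun k => k + N) fun i j h => Nat.add_lt_add_right h N).apply
      fun q hq _ => mul_mem (mul_mem (inv_mem hinv) hq) hinv)
  obtain ⟨hs, hJ⟩ := H.eq_of_mem (h := (g 0)⁻¹ * g k) (x := (g 0)⁻¹ p)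
    (mul_mem hinv (hg k)) (by
      rw [mul_inv_rev, inv_inv, mul_apply, apply_inv_self]
      exact hgp k) (hgp 0)
  have := H.inv _ _ hJ _ (hgx k)
  rw [mul_apply, apply_inv_self] at this
  exact hs ▸ this

theorem isBoundedParabolicPt_group (hGd : IsDiscreteConvGroup G) (hsh : Shrinks G₀ J B)
    (hG₀ : IsGeomFinite G₀) {p : M} (hp : p ∈ limitSet G₀) (hpb : IsBoundedParabolicPt G₀ p) :
    IsBoundedParabolicPt G p := by
  refine ⟨hpb.1.mono H.le_group, ?_⟩
  by_contra! hcon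
  have hbad : ∀ n : ℕ, ∃ x ∈ limitSet G \ {p}, ∀ h ∈ G, h p = p →
      h x ∉ limitSet G \ Metric.ball p (1 / ((n : ℝ) + 1)) := fun n =>
    hcon _ ((isClosed_limitSet hGd H.threePoints).sdiff Metric.isOpen_ball).isCompact
      (sdiff_subset_sdiff_right (singleton_subset_iff.2 (Metric.mem_ball_self (by positivity))))
  choose x hx hxh using hbad
  refine H.not_escapes hsh hG₀ hp hpb (fun k => (hx k).1) (fun k => (hx k).2) fun U hU => ?_
  obtain ⟨ε, hε, hεU⟩ := Metric.mem_nhds_iff.1 hU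
  filter_upwards [(tendsto_one_div_add_atTop_nhds_zero_nat (𝕜 := ℝ)).eventually
    (gt_mem_nhds hε)] with n hn h hh hhp
  by_contra hnU
  refine hxh n h (H.le_group hh) hhp ⟨apply_mem_limitSet (H.le_group hh) (hx n).1, fun hb => ?_⟩
  exact hnU (hεU (Metric.ball_subset_ball hn.le hb))

/-- A limit point of `G` whose orbit avoids the limit set of `G₀` is conical. -/
theorem isConicalLimitPt_of_orbit (hGd : IsDiscreteConvGroup G) (hsh : Shrinks G₀ J B)
    (hC : ∀ s, ∃ C, IsClosed C ∧ (∀ x ∈ C, x ∉ limitSet (J s)) ∧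
      ∀ x ∈ limitSet G, x ∉ limitSet (J s) → ∃ j ∈ J s, j x ∈ C)
    {x : M} (hx : x ∈ limitSet G) (hxG₀ : ∀ u ∈ G, u x ∉ limitSet G₀) :
    IsConicalLimitPt G x := by
  have hnext : ∀ u : M ≃ₜ M, ∃ s h, u ∈ G → h ∈ G₀ ∧ h⁻¹ (u x) ∈ B s := fun u => by
    by_cases hu : u ∈ G
    · obtain ⟨s, h, hh, hs⟩ := (H.limitSet_cover hsh (apply_mem_limitSet hu hx)).resolve_left
        (hxG₀ u hu)
      exact ⟨s, h, fun _ => ⟨hh, hs⟩⟩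
    · exact ⟨true, 1, fun h => (hu h).elim⟩
  choose S L hSL using hnext
  set u : ℕ → M ≃ₜ M := fun n => Nat.rec 1 (fun _ v => F (!(S v)) * (L v)⁻¹ * v) n with hu
  have hu0 : u 0 = 1 := rfl
  have hus : ∀ n, u (n + 1) = F (!(S (u n))) * (L (u n))⁻¹ * u n := fun n => rfl
  have huG : ∀ n, u n ∈ G := fun n => by
    induction n with
    | zero => exact one_mem _
    | succ n ih =>
      rw [hus]
      exact mul_mem (mul_mem (H.F_mem _) (inv_mem (H.le_group (hSL _ ih).1))) ih
  set s : ℕ → Bool := fun n => S (u n) with hs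
  set h : ℕ → M ≃ₜ M := fun n => L (u n) with hh
  have hhG : ∀ n, h n ∈ G₀ := fun n => (hSL _ (huG n)).1
  have hB : ∀ n, (h n)⁻¹ (u n x) ∈ B (s n) := fun n => (hSL _ (huG n)).2
  have hux : ∀ n z, u (n + 1) z = F (!(s n)) ((h n)⁻¹ (u n z)) := fun n z => rfl
  have hxG : ∀ n, u n x ∈ limitSet G := fun n => apply_mem_limitSet (huG n) hx
  have hnB : ∀ n, u (n + 1) x ∉ B (!(s n)) := fun n hmem => by
    have hi := H.le_group (inv_mem (hhG n))
    refine hxG₀ _ (mul_mem hi (huG n)) (H.limitSet_le (s n) ?_)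
    exact H.mem_limitSet_of_mem_of_mem hsh (apply_mem_limitSet hi (hxG n)) (hB n)
      (by rwa [← hux])
  have hred : ∀ n, ¬(s (n + 1) = !(s n) ∧ h (n + 1) ∈ J (!(s n))) := fun n hn => by
    refine hnB n ?_
    have h1 := hB (n + 1)
    rw [hn.1] at h1
    have := H.inv _ _ hn.2 _ h1
    rwa [apply_inv_self] at this
  obtain ⟨a, ha⟩ := H.proper
  have hword : ∀ d n, (h n)⁻¹ (u n ((u (n + d + 1))⁻¹ a)) ∈ B (s n) := fun d => by
    have hstep : ∀ n z, (h n)⁻¹ (u n ((u (n + 1))⁻¹ z)) = F (s n) z := fun n z => by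
      have := hux n ((u (n + 1))⁻¹ z)
      rw [apply_inv_self] at this
      have h1 := congrArg (F (s n)) this
      rw [H.F_apply_not] at h1
      exact h1.symm
    induction d with
    | zero =>
      intro n
      rw [Nat.add_zero, hstep]
      exact H.mapsTo _ _ (ha 1 (one_mem _) _)
    | succ d ih =>
      intro n
      have h1 := ih (n + 1)
      have h2 := H.mapsTo (s n) _ (H.not_mem_of_ne (s := s n) (h := h (n + 1)) (s' := s (n + 1)) (hhG (n + 1))
        h1 (hred n))
      rw [← hstep, inv_apply_self] at h2
      rwa [show n + (d + 1) + 1 = n + 1 + d + 1 by omega]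
  have hdist : ∀ m n, m < n → u m * (u n)⁻¹ ∉ G₀ := fun m n hmn hmem => by
    have h1 := hword (n - m - 1) m
    rw [show m + (n - m - 1) + 1 = n by omega] at h1
    exact ha _ (mul_mem (inv_mem (hhG m)) hmem) _ h1
  have htest : ∀ z, (h 0)⁻¹ z ∉ B (s 0) → ∀ n, u (n + 1) z ∈ B (!(s n)) := fun z hz n => by
    induction n with
    | zero =>
      rw [hux]
      refine H.mapsTo _ _ ?_
      rwa [Bool.not_not]
    | succ n ih =>
      rw [hux (n + 1)]
      refine H.mapsTo _ _ ?_
      rw [Bool.not_not]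
      exact fun hmem => H.not_mem_of_ne (hhG (n + 1)) hmem (hred n) ih
  obtain ⟨b₀, hb₀⟩ := H.int_nonempty (!(s 0))
  replace hb₀ := interior_subset hb₀
  have hz₁ : (h 0)⁻¹ a ∉ B (s 0) := ha _ (inv_mem (hhG 0)) _
  have hz₂ : (h 0)⁻¹ (h 0 b₀) ∉ B (s 0) := by
    have := H.cross (!(s 0)) 1 (one_mem _) b₀ hb₀
    rw [Bool.not_not, one_apply] at this
    rwa [inv_apply_self]
  have hne : a ≠ h 0 b₀ := fun hab => ha _ (inv_mem (hhG 0)) (!(s 0)) (by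
    rwa [hab, inv_apply_self])
  obtain ⟨φ, hφ, s₀, hs₀⟩ := exists_strictMono_const s
  obtain ⟨C, hCcl, hCΛ, hCcov⟩ := hC (!s₀)
  choose j hj hjC using fun k => hCcov (u (φ k + 1) x) (hxG (φ k + 1))
    fun hmem => hxG₀ _ (huG (φ k + 1)) (H.limitSet_le (!s₀) hmem)
  have hinj : Function.Injective fun k => j k * u (φ k + 1) := by
    have key : ∀ m n, m < n → j m * u (φ m + 1) ≠ j n * u (φ n + 1) := fun m n hmn heq => by
      refine hdist (φ m + 1) (φ n + 1) (Nat.add_lt_add_right (hφ hmn) 1) ?_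
      have : u (φ m + 1) * (u (φ n + 1))⁻¹ = (j m)⁻¹ * j n := by
        rw [mul_inv_eq_iff_eq_mul, mul_assoc, ← heq, inv_mul_cancel_left]
      rw [this]
      exact H.le _ (mul_mem (inv_mem (hj m)) (hj n))
    intro m n hmn
    by_contra hne
    rcases lt_or_gt_of_ne hne with hlt | hlt
    exacts [key m n hlt hmn, key n m hlt hmn.symm]
  obtain ⟨χ, hχ, b, c, hbc⟩ := hGd.exists_convIn
    (fun k => mul_mem (H.le_group (H.le _ (hj k))) (huG (φ k + 1))) hinj
  have hb : b ∈ B (!s₀) := by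
    have key : ∀ z, z ≠ c → (h 0)⁻¹ z ∉ B (s 0) → b ∈ B (!s₀) := fun z hz hzB =>
      (H.isClosed _).mem_of_tendsto (hbc.tendsto hz) (Eventually.of_forall fun k => by
        have := htest z hzB (φ (χ k))
        rw [hs₀] at this
        exact H.inv _ _ (hj _) _ this)
    by_cases hac : a = c
    · exact key (h 0 b₀) (fun h => hne (hac.trans h.symm)) hz₂
    · exact key a hac hz₁
  obtain ⟨y, -, ρ, hρ, hy⟩ := isCompact_univ.tendsto_subseq
    (fun k => mem_univ ((j (χ k) * u (φ (χ k) + 1)) x))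
  refine isConicalLimitPt_of_convIn (hbc.comp hρ) hy ?_
  rintro rfl
  have hyC : y ∈ C := hCcl.mem_of_tendsto hy (Eventually.of_forall fun k => hjC _)
  refine hCΛ y hyC (H.mem_limitSet_of_mem_of_mem hsh hbc.attr_mem hb ?_)
  rw [Bool.not_not]
  refine (H.isClosed _).mem_of_tendsto (((F s₀).continuous.tendsto y).comp hy)
    (Eventually.of_forall fun k => ?_)
  set i := χ (ρ k) with hi
  have h1 := H.inv s₀ _ (H.conj' s₀ (hj i)) ((h (φ i))⁻¹ (u (φ i) x)) (hs₀ i ▸ hB (φ i))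
  have h2 : F (!s₀) ((h (φ i))⁻¹ (u (φ i) x)) = u (φ i + 1) x := by
    rw [hux, hs₀]
  rw [mul_apply, mul_apply, h2] at h1
  exact h1

theorem isGeomFinite_group (hGd : IsDiscreteConvGroup G) (hJ : ∀ s, IsGeomFinite (J s))
    (hG₀ : IsGeomFinite G₀) : IsGeomFinite G := by
  have hsh := H.shrinks hJ hG₀
  have hcase : ∀ p ∈ limitSet G₀, IsConicalLimitPt G p ∨ IsBoundedParabolicPt G p := fun p hp =>
    (hG₀ p hp).imp (fun h => h.mono H.le_group) fun h =>
      H.isBoundedParabolicPt_group hGd hsh hG₀ hp h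
  have hpar : ∀ s, ∀ ξ ∈ limitSet (J s), IsParabolicPt (J s) ξ → IsBoundedParabolicPt G ξ :=
    fun s ξ hξ hp => (hcase ξ (H.limitSet_le s hξ)).resolve_left
      (hp.not_conical ((H.le s).trans H.le_group) hGd H.threePoints)
  intro x hx
  by_cases hxG₀ : ∀ u ∈ G, u x ∉ limitSet G₀
  · exact Or.inl (H.isConicalLimitPt_of_orbit hGd hsh
      (fun s => H.exists_transversal_limitSet s (hJ s) (hpar s)) hx hxG₀)
  · push Not at hxG₀
    obtain ⟨u, hu, hux⟩ := hxG₀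
    refine (hcase _ hux).imp (isConicalLimitPt_apply_iff hu).1 fun hb => ?_
    have := hb.apply (inv_mem hu)
    rwa [inv_apply_self] at this

end SignedPingPong

end PingPong

/-- **Theorem B(iv).** With `G₀` a discrete convergence group,
`J₁, J₋₁ ≤ G₀` geometrically finite, `f` generating an infinite cyclic discrete
convergence group with `f J₋₁ f⁻¹ = J₁`, `G₀` in HNN ping-pong position, and
`G = ⟨G₀, f⟩` acting as a convergence group: `G` is geometrically finite if and only
if `G₀` is geometrically finite. -/
theorem statement_11 {M : Type*} [TopologicalSpace M] [CompactSpace M]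
    [TopologicalSpace.MetrizableSpace M]
    (G₀ J₁ Jm G : Subgroup (M ≃ₜ M)) (f : M ≃ₜ M)
    (hd₀ : IsDiscreteConvGroup G₀)
    (hJ₁G₀ : J₁ ≤ G₀) (hJmG₀ : Jm ≤ G₀)
    (hJ₁gf : IsGeomFinite J₁) (hJmgf : IsGeomFinite Jm)
    (hford : ¬IsOfFinOrder f) (hfd : IsDiscreteConvGroup (Subgroup.zpowers f))
    (hconj : ∀ x : M ≃ₜ M, x ∈ J₁ ↔ f⁻¹ * x * f ∈ Jm)
    (hpp : ∃ B₁ Bm : Set M, HNNPingPong G₀ J₁ Jm f B₁ Bm)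
    (hG : G = G₀ ⊔ Subgroup.zpowers f) (hGconv : IsConvGroup G) :
    IsGeomFinite G ↔ IsGeomFinite G₀ := by
  let := TopologicalSpace.metrizableSpaceMetric M
  obtain ⟨B₁, Bm, hpp⟩ := hpp
  have H := hpp.signed hd₀ hJ₁G₀ hJmG₀ hconj hG
  have hGd := H.discrete_group hGconv
  have hJ : ∀ s, IsGeomFinite (bif s then J₁ else Jm) := by
    rintro (_ | _)
    exacts [hJmgf, hJ₁gf]
  exact ⟨H.isGeomFinite_base hGd hJ, H.isGeomFinite_group hGd hJ⟩

end ConvergenceGroups
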